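/- arXiv:2506.23264 — 3 statements merged into one kernel-verified Lean document; each statement's English description precedes it below -/
import Mathlib

section
/- For every integer k ≥ 1 there exists a constant c > 0 depending only on k such that for all n ≥ 2k and all k-uniform hypergraphs G and H on n vertices, disc(G,H) ≥ c · n^{(k+1)/2} · max_{1≤r≤k} (W^r(G) · W^r(H))². -/
open Finset

/-- Inner signed average over k-subsets R crossing each pair {a i, b i}:
E_R [ (-1)^{|R ∩ {b_1,...,b_r}|} f(R) ]. -/
noncomputable def signedAvg {V : Type*} [Fintype V] [DecidableEq V] (k : ℕ) {r : ℕ}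
    (f : Finset V → ℝ) (a b : Fin r → V) : ℝ :=
  (∑ R ∈ (Finset.univ.powersetCard k).filter
      (fun R => ∀ i, (R ∩ {a i, b i}).card = 1),
      (-1 : ℝ) ^ (R ∩ Finset.image b Finset.univ).card * f R) /
  (((Finset.univ.powersetCard k).filter
      (fun R => ∀ i, (R ∩ {a i, b i}).card = 1)).card)

/-- The level-r weight W^r(f) of a function on k-subsets: the square root of the
average, over all sequences (a_1,b_1,...,a_r,b_r) of 2r distinct vertices, of the
square of the inner signed average. -/
noncomputable def Wpow {V : Type*} [Fintype V] [DecidableEq V] (k r : ℕ)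
    (f : Finset V → ℝ) : ℝ :=
  Real.sqrt
    ((∑ p ∈ (Finset.univ : Finset ((Fin r → V) × (Fin r → V))).filter
        (fun p => Function.Injective (Sum.elim p.1 p.2)),
        (signedAvg k f p.1 p.2) ^ 2) /
      (((Finset.univ : Finset ((Fin r → V) × (Fin r → V))).filter
        (fun p => Function.Injective (Sum.elim p.1 p.2))).card))

/-- Indicator function of a hypergraph, viewed as a real-valued function on finsets. -/
def hyperInd {V : Type*} [DecidableEq V] (G : Finset (Finset V)) : Finset V → ℝ :=
  fun S => if S ∈ G then 1 else 0

/-- Image of the edge set of a hypergraph under a vertex permutation. -/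
def permEdges {n : ℕ} (σ : Equiv.Perm (Fin n)) (G : Finset (Finset (Fin n))) :
    Finset (Finset (Fin n)) := G.image (fun e => e.image σ)

/-- Relative discrepancy of two k-uniform hypergraphs on n vertices:
the maximum over all relabelings G' ≅ G, H' ≅ H on the same vertex set of
| |E(G') ∩ E(H')| - p q C(n,k) |, where p q C(n,k) = e(G) e(H) / C(n,k). -/
noncomputable def disc (n k : ℕ) (G H : Finset (Finset (Fin n))) : ℝ :=
  ⨆ p : Equiv.Perm (Fin n) × Equiv.Perm (Fin n),
    |((permEdges p.1 G ∩ permEdges p.2 H).card : ℝ) -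
      ((G.card : ℝ) * H.card) / (n.choose k)|


/-- sign of a bit -/
noncomputable def sg (b : Bool) : ℝ := if b then -1 else 1

lemma nodes_exist (k : ℕ) (hk : 1 ≤ k) : ∃ (l t : Fin (k+1) → ℝ), (∀ j, 0 ≤ t j ∧ t j ≤ 1) ∧
    ∀ d ≤ k, ∑ j, l j * t j ^ d = if d = 1 then 1 else 0 := by
  have hk' : (0:ℝ) < k := by exact_mod_cast hk
  let t : Fin (k+1) → ℝ := fun j => (j : ℝ) / k
  have hinj : Function.Injective t := by
    intro i j h
    simp only [t] at h
    rw [div_left_inj' hk'.ne'] at h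
    exact Fin.ext (by exact_mod_cast h)
  have hdet : IsUnit (Matrix.vandermonde t).transpose.det := by
    rw [Matrix.det_transpose]
    exact isUnit_iff_ne_zero.mpr (Matrix.det_vandermonde_ne_zero_iff.mpr hinj)
  refine ⟨(Matrix.vandermonde t).transpose⁻¹.mulVec (fun d : Fin (k+1) => if (d:ℕ) = 1 then (1:ℝ) else 0), t, ?_, ?_⟩
  · intro j
    refine ⟨by positivity, ?_⟩
    simp only [t]
    rw [div_le_one hk']
    exact_mod_cast Nat.lt_succ_iff.mp j.2
  · intro d hd
    have h : (Matrix.vandermonde t).transpose.mulVec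
      ((Matrix.vandermonde t).transpose⁻¹.mulVec (fun d : Fin (k+1) => if (d:ℕ) = 1 then (1:ℝ) else 0)) =
        (fun d : Fin (k+1) => if (d:ℕ) = 1 then (1:ℝ) else 0) := by
      rw [Matrix.mulVec_mulVec, Matrix.mul_nonsing_inv _ hdet, Matrix.one_mulVec]
    have h2 := congrFun h ⟨d, Nat.lt_succ_iff.mpr hd⟩
    simp only at h2
    rw [← h2]
    simp only [Matrix.mulVec, dotProduct, Matrix.transpose_apply, Matrix.vandermonde_apply]
    refine Finset.sum_congr rfl fun j _ => by ring

/-- degree bound on one block -/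
def DegLE {m : ℕ} (k : ℕ) (g : (Fin m → Bool) → ℝ) : Prop :=
  ∀ A : Finset (Fin m), k < #A → ∑ e, g e * ∏ i ∈ A, sg (e i) = 0

lemma block_expand {m k : ℕ} (l t : Fin (k+1) → ℝ)
    (hl : ∀ d ≤ k, ∑ j, l j * t j ^ d = if d = 1 then 1 else 0)
    (g : (Fin m → Bool) → ℝ) (hg : DegLE k g) (s : Fin m → ℝ) (z : ℂ) :
    ∑ j, (l j : ℂ) * ∑ e, (g e : ℂ) * ∏ i, (1 + z * (t j * s i * sg (e i) : ℝ)) =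
      z * ((∑ i, s i * ∑ e, g e * sg (e i) : ℝ) : ℂ) := by
  obtain ⟨P, hP⟩ : ∃ P : Finset (Fin m) → ℝ, ∀ A, P A = (∏ i ∈ A, s i) * ∑ e, g e * ∏ i ∈ A, sg (e i) :=
    ⟨_, fun _ => rfl⟩
  have h1 : ∀ j, ∑ e, (g e : ℂ) * ∏ i, (1 + z * (t j * s i * sg (e i) : ℝ)) =
      ∑ A : Finset (Fin m), (z * t j) ^ #A * (P A : ℂ) := by
    intro j
    simp_rw [Finset.prod_one_add, Finset.mul_sum]
    rw [Finset.sum_comm]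
    simp only [powerset_univ]
    refine Finset.sum_congr rfl fun A _ => ?_
    rw [hP]
    push_cast
    rw [Finset.mul_sum, Finset.mul_sum]
    refine Finset.sum_congr rfl fun e _ => ?_
    have : ∀ i, z * ((t j : ℂ) * s i * sg (e i)) = (z * t j) * (s i * sg (e i)) := by
      intro i; ring
    simp_rw [this, Finset.prod_mul_distrib, Finset.prod_const]
    ring
  have h2 : ∀ A : Finset (Fin m), ∑ j, (l j : ℂ) * ((z * t j) ^ #A * (P A : ℂ)) =
      if #A = 1 then z * (P A : ℂ) else 0 := by
    intro A
    by_cases hA : k < #A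
    · rw [hP, hg A hA]
      simp
    · have h3 := congrArg (fun x : ℝ => (x : ℂ)) (hl #A (not_lt.mp hA))
      simp only [Complex.ofReal_sum, Complex.ofReal_mul, Complex.ofReal_pow] at h3
      have : ∑ j, (l j : ℂ) * ((z * t j) ^ #A * (P A : ℂ)) =
        (∑ j, (l j : ℂ) * (t j:ℂ)^ #A) * (z ^ #A * (P A : ℂ)) := by
        rw [Finset.sum_mul]
        refine Finset.sum_congr rfl fun j _ => by rw [mul_pow]; ring
      rw [this, h3]
      split_ifs with h
      · rw [h]; simp
      · simp
  simp_rw [h1, Finset.mul_sum]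
  rw [Finset.sum_comm, Finset.sum_congr rfl fun A _ => h2 A]
  rw [← Finset.sum_filter, ← Finset.mul_sum]
  congr 1
  have : (univ.filter fun A : Finset (Fin m) => #A = 1) = univ.image (fun i => ({i} : Finset (Fin m))) := by
    ext A
    simp only [mem_filter, mem_univ, true_and, mem_image, Finset.card_eq_one]
    exact ⟨fun ⟨a, h⟩ => ⟨a, h.symm⟩, fun ⟨a, h⟩ => ⟨a, h.symm⟩⟩
  rw [this, Finset.sum_image (fun a _ b _ h => by simpa using h)]
  simp [hP, Finset.mul_sum]

lemma sg_abs (b : Bool) : |sg b| = 1 := by cases b <;> simp [sg]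

/-- choose signs -/
lemma exists_signs {ι : Type*} (c : ι → ℝ) : ∃ s : ι → ℝ, (∀ i, |s i| = 1) ∧ ∀ i, s i * c i = |c i| := by
  refine ⟨fun i => if 0 ≤ c i then 1 else -1, fun i => ?_, fun i => ?_⟩
  · dsimp only; split_ifs <;> simp
  · dsimp only
    split_ifs with h
    · rw [abs_of_nonneg h]; ring
    · rw [abs_of_neg (not_le.mp h)]; ring

lemma block_sup {m k : ℕ} (l t : Fin (k+1) → ℝ) (ht : ∀ j, 0 ≤ t j ∧ t j ≤ 1)
    (hl : ∀ d ≤ k, ∑ j, l j * t j ^ d = if d = 1 then 1 else 0)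
    (g : (Fin m → Bool) → ℝ) (hg : DegLE k g) (D : ℝ) (hD : ∀ e, |g e| ≤ D) :
    ∑ i, |∑ e, g e * sg (e i)| ≤ (∑ j, |l j|) * (2 ^ m * D) := by
  obtain ⟨s, hs, hsc⟩ := exists_signs (fun i => ∑ e, g e * sg (e i))
  have h := block_expand l t hl g hg s 1
  rw [one_mul, Finset.sum_congr rfl fun i _ => hsc i] at h
  have h0 : 0 ≤ ∑ i, |∑ e, g e * sg (e i)| := Finset.sum_nonneg fun i _ => abs_nonneg _
  rw [← abs_of_nonneg h0, ← Real.norm_eq_abs, ← Complex.norm_real, ← h, Finset.sum_mul]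
  refine (norm_sum_le _ _).trans (Finset.sum_le_sum fun j _ => ?_)
  rw [norm_mul, Complex.norm_real, Real.norm_eq_abs]
  refine mul_le_mul_of_nonneg_left ?_ (abs_nonneg _)
  have hb : ∀ e : Fin m → Bool, ‖∏ i, (1 + (1:ℂ) * (t j * s i * sg (e i) : ℝ))‖ = ∏ i, (1 + t j * s i * sg (e i)) := by
    intro e
    rw [norm_prod]
    refine Finset.prod_congr rfl fun i _ => ?_
    have : (1 + (1:ℂ) * (t j * s i * sg (e i) : ℝ)) = ((1 + t j * s i * sg (e i) : ℝ) : ℂ) := by push_cast; ring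
    rw [this, Complex.norm_real, Real.norm_eq_abs, abs_of_nonneg]
    have : |t j * s i * sg (e i)| ≤ 1 := by
      rw [abs_mul, abs_mul, hs, sg_abs, abs_of_nonneg (ht j).1]; linarith [(ht j).2]
    linarith [(abs_le.mp this).1]
  have hb0 : ∀ e : Fin m → Bool, 0 ≤ ∏ i, (1 + t j * s i * sg (e i)) := fun e => by
    rw [← hb]; exact norm_nonneg _
  have hsum : ∑ e : Fin m → Bool, ∏ i, (1 + t j * s i * sg (e i)) = 2 ^ m := by
    have := (Finset.prod_univ_sum (fun _ : Fin m => (univ : Finset Bool)) (fun i b => 1 + t j * s i * sg b)).symm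
    rw [Fintype.piFinset_univ] at this
    rw [this]
    have : ∀ i : Fin m, ∑ b : Bool, (1 + t j * s i * sg b) = 2 := by
      intro i; simp [sg]; ring
    rw [Finset.prod_congr rfl fun i _ => this i]; simp
  calc ‖∑ e : Fin m → Bool, (g e : ℂ) * ∏ i, (1 + (1:ℂ) * (t j * s i * sg (e i) : ℝ))‖
      ≤ ∑ e : Fin m → Bool, D * ∏ i, (1 + t j * s i * sg (e i)) := by
        refine (norm_sum_le _ _).trans (Finset.sum_le_sum fun e _ => ?_)
        rw [norm_mul, hb, Complex.norm_real, Real.norm_eq_abs]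
        exact mul_le_mul_of_nonneg_right (hD e) (hb0 e)
    _ = 2 ^ m * D := by rw [← Finset.mul_sum, hsum]; ring

lemma block_l1 {m k : ℕ} (hm : 1 ≤ m) (l t : Fin (k+1) → ℝ) (ht : ∀ j, 0 ≤ t j ∧ t j ≤ 1)
    (hl : ∀ d ≤ k, ∑ j, l j * t j ^ d = if d = 1 then 1 else 0)
    (g : (Fin m → Bool) → ℝ) (hg : DegLE k g) :
    ∑ i, |∑ e, g e * sg (e i)| ≤ (∑ j, |l j|) * Real.exp 1 * √m * ∑ e, |g e| := by
  obtain ⟨s, hs, hsc⟩ := exists_signs (fun i => ∑ e, g e * sg (e i))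
  have hm' : (0:ℝ) < √m := Real.sqrt_pos.mpr (by exact_mod_cast hm)
  have h := block_expand l t hl g hg s (Complex.I * ((√m)⁻¹ : ℝ))
  rw [Finset.sum_congr rfl fun i _ => hsc i] at h
  have h0 : 0 ≤ ∑ i, |∑ e, g e * sg (e i)| := Finset.sum_nonneg fun i _ => abs_nonneg _
  have h2 := congrArg norm h
  rw [norm_mul, norm_mul, Complex.norm_I, one_mul, Complex.norm_real, Complex.norm_real, Real.norm_eq_abs,
    Real.norm_eq_abs, abs_of_nonneg h0, abs_of_pos (inv_pos.mpr hm')] at h2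
  have hb : ∀ j, ∀ e : Fin m → Bool, ‖∏ i, (1 + (Complex.I * ((√m)⁻¹ : ℝ)) * (t j * s i * sg (e i) : ℝ))‖ ≤ Real.exp 1 := by
    intro j e
    rw [norm_prod]
    calc ∏ i, ‖(1 + (Complex.I * ((√m)⁻¹ : ℝ)) * (t j * s i * sg (e i) : ℝ))‖ ≤ ∏ i : Fin m, Real.exp (1 / m) := by
          refine Finset.prod_le_prod (fun i _ => norm_nonneg _) fun i _ => ?_
          set y : ℝ := t j * s i * sg (e i) with hy
          have hy1 : |y| ≤ 1 := by
            rw [hy, abs_mul, abs_mul, hs, sg_abs, abs_of_nonneg (ht j).1]; linarith [(ht j).2]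
          have hy2 : y^2 ≤ 1 := by rw [← sq_abs]; exact pow_le_one₀ (abs_nonneg _) hy1
          have : (1 + (Complex.I * ((√m)⁻¹ : ℝ)) * (y : ℝ)) = ((1:ℝ):ℂ) + (((√m)⁻¹ * y : ℝ):ℂ) * Complex.I := by
            push_cast; ring
          rw [this, Complex.norm_add_mul_I]
          have h3 : ((√m)⁻¹ * y)^2 ≤ 1 / m := by
            rw [mul_pow, inv_pow, Real.sq_sqrt (Nat.cast_nonneg _), one_div]
            exact mul_le_of_le_one_right (by positivity) hy2
          have h4 : (0:ℝ) ≤ 1 / m := by positivity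
          rw [Real.sqrt_le_left (Real.exp_pos _).le]
          have h5 := Real.add_one_le_exp (1 / (m:ℝ))
          nlinarith
      _ = Real.exp 1 := by
          rw [Finset.prod_const, ← Real.exp_nat_mul, Finset.card_univ, Fintype.card_fin]
          congr 1
          have : (m:ℝ) ≠ 0 := by positivity
          field_simp
  have h6 : (√m)⁻¹ * ∑ i, |∑ e, g e * sg (e i)| ≤ (∑ j, |l j|) * (Real.exp 1 * ∑ e, |g e|) := by
    rw [← h2, Finset.sum_mul]
    refine (norm_sum_le _ _).trans (Finset.sum_le_sum fun j _ => ?_)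
    rw [norm_mul, Complex.norm_real, Real.norm_eq_abs]
    refine mul_le_mul_of_nonneg_left ?_ (abs_nonneg _)
    rw [Finset.mul_sum]
    refine (norm_sum_le _ _).trans (Finset.sum_le_sum fun e _ => ?_)
    rw [norm_mul, Complex.norm_real, Real.norm_eq_abs, mul_comm]
    exact mul_le_mul_of_nonneg_right (hb j e) (abs_nonneg _)
  rw [inv_mul_le_iff₀ hm'] at h6
  linarith

/-- degree bound in every block -/
def MDeg {r m : ℕ} (k : ℕ) (Y : (Fin r → Fin m → Bool) → ℝ) : Prop :=
  ∀ j e, DegLE k (fun d => Y (Function.update e j d))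

lemma sum_fin_cons {r : ℕ} {α : Type*} [Fintype α] (F : (Fin (r+1) → α) → ℝ) :
    ∑ x, F x = ∑ a, ∑ x, F (Fin.cons a x) := by
  rw [← (Fin.consEquiv (fun _ : Fin (r+1) => α)).sum_comp, Fintype.sum_prod_type]
  rfl

lemma coef_cons {r m : ℕ} (Y : (Fin (r+1) → Fin m → Bool) → ℝ) (i0 : Fin m) (i : Fin r → Fin m) :
    ∑ e, Y e * ∏ j, sg (e j ((Fin.cons i0 i : Fin (r+1) → Fin m) j)) =
     ∑ e, (∑ d, Y (Fin.cons d e) * sg (d i0)) * ∏ j, sg (e j (i j)) := by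
  rw [sum_fin_cons, Finset.sum_comm]
  refine Finset.sum_congr rfl fun e _ => ?_
  rw [Finset.sum_mul]
  refine Finset.sum_congr rfl fun d _ => ?_
  rw [Fin.prod_univ_succ]
  simp only [Fin.cons_zero, Fin.cons_succ]
  ring

lemma mdeg_tail {r m k : ℕ} (Y : (Fin (r+1) → Fin m → Bool) → ℝ) (hY : MDeg k Y) (i0 : Fin m) :
    MDeg k (fun e : Fin r → Fin m → Bool => ∑ d, Y (Fin.cons d e) * sg (d i0)) := by
  intro j e A hA
  simp_rw [Finset.sum_mul]
  rw [Finset.sum_comm]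
  refine Finset.sum_eq_zero fun d _ => ?_
  have := hY j.succ (Fin.cons d e) A hA
  simp_rw [Fin.cons_update]
  calc _ = sg (d i0) * ∑ x : Fin m → Bool, Y (Function.update (Fin.cons d e : Fin (r+1) → Fin m → Bool) j.succ x) * ∏ i ∈ A, sg (x i) := by
        rw [Finset.mul_sum]; refine Finset.sum_congr rfl fun x _ => by ring
    _ = 0 := by rw [this, mul_zero]

lemma mdeg_head {r m k : ℕ} (Y : (Fin (r+1) → Fin m → Bool) → ℝ) (hY : MDeg k Y) (e : Fin r → Fin m → Bool) :
    DegLE k (fun d => Y (Fin.cons d e)) := by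
  intro A hA
  have := hY 0 (Fin.cons (fun _ => true) e) A hA
  simpa [Fin.update_cons_zero] using this

lemma multi_l1 {m k : ℕ} (B : ℝ) (hB : 0 ≤ B)
    (hb : ∀ g : (Fin m → Bool) → ℝ, DegLE k g → ∑ i, |∑ e, g e * sg (e i)| ≤ B * ∑ e, |g e|) :
    ∀ (r : ℕ) (Y : (Fin r → Fin m → Bool) → ℝ), MDeg k Y →
      ∑ i : Fin r → Fin m, |∑ e, Y e * ∏ j, sg (e j (i j))| ≤ B ^ r * ∑ e, |Y e| := by
  intro r
  induction r with
  | zero => intro Y _; simp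
  | succ r ih =>
    intro Y hY
    rw [sum_fin_cons]
    calc _ ≤ ∑ i0, B ^ r * ∑ e : Fin r → Fin m → Bool, |∑ d, Y (Fin.cons d e) * sg (d i0)| := by
          refine Finset.sum_le_sum fun i0 _ => ?_
          simp_rw [coef_cons]
          exact ih _ (mdeg_tail Y hY i0)
      _ = B ^ r * ∑ e : Fin r → Fin m → Bool, ∑ i0, |∑ d, Y (Fin.cons d e) * sg (d i0)| := by
          rw [← Finset.mul_sum, Finset.sum_comm]
      _ ≤ B ^ r * ∑ e : Fin r → Fin m → Bool, (B * ∑ d, |Y (Fin.cons d e)|) := by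
          refine mul_le_mul_of_nonneg_left (Finset.sum_le_sum fun e _ => ?_) (by positivity)
          exact hb _ (mdeg_head Y hY e)
      _ = _ := by rw [← Finset.mul_sum, Finset.sum_comm, ← sum_fin_cons (fun x => |Y x|), pow_succ]; ring

lemma multi_sup {m k : ℕ} (B C : ℝ) (hB : 0 ≤ B)
    (hb : ∀ g : (Fin m → Bool) → ℝ, DegLE k g → ∑ i, |∑ e, g e * sg (e i)| ≤ B * ∑ e, |g e|)
    (hc : ∀ (g : (Fin m → Bool) → ℝ), DegLE k g → ∀ D : ℝ, (∀ e, |g e| ≤ D) →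
      ∑ i, |∑ e, g e * sg (e i)| ≤ C * (2 ^ m * D))
    (r : ℕ) (Y : (Fin (r+1) → Fin m → Bool) → ℝ) (hY : MDeg k Y) (D : ℝ) (hD : ∀ e, |Y e| ≤ D) :
      ∑ i : Fin (r+1) → Fin m, |∑ e, Y e * ∏ j, sg (e j (i j))| ≤
        B ^ r * C * D * Fintype.card (Fin (r+1) → Fin m → Bool) := by
    rw [sum_fin_cons]
    calc _ ≤ ∑ i0, B ^ r * ∑ e : Fin r → Fin m → Bool, |∑ d, Y (Fin.cons d e) * sg (d i0)| := by
          refine Finset.sum_le_sum fun i0 _ => ?_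
          simp_rw [coef_cons]
          exact multi_l1 B hB hb r _ (mdeg_tail Y hY i0)
      _ = B ^ r * ∑ e : Fin r → Fin m → Bool, ∑ i0, |∑ d, Y (Fin.cons d e) * sg (d i0)| := by
          rw [← Finset.mul_sum, Finset.sum_comm]
      _ ≤ B ^ r * ∑ e : Fin r → Fin m → Bool, (C * (2 ^ m * D)) := by
          refine mul_le_mul_of_nonneg_left (Finset.sum_le_sum fun e _ => ?_) (by positivity)
          exact hc _ (mdeg_head Y hY e) D fun d => hD _
      _ = _ := by
          simp only [Finset.sum_const, Finset.card_univ, Fintype.card_fun, Fintype.card_bool, Fintype.card_fin,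
            nsmul_eq_mul]
          push_cast
          ring

section combi
variable {V : Type*} [Fintype V] [DecidableEq V]

/-- signed kernel -/
noncomputable def kap {r : ℕ} (a b : Fin r → V) (R : Finset V) : ℝ :=
  ∏ j, ((if a j ∈ R then (1:ℝ) else 0) - (if b j ∈ R then (1:ℝ) else 0))

/-- signed sum -/
noncomputable def ksum (k : ℕ) {r : ℕ} (f : Finset V → ℝ) (a b : Fin r → V) : ℝ :=
  ∑ R ∈ (univ : Finset V).powersetCard k, kap a b R * f R

/-- number of crossing sets -/
noncomputable def kcnt (k : ℕ) {r : ℕ} (a b : Fin r → V) : ℝ :=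
  ∑ R ∈ (univ : Finset V).powersetCard k, kap a b R ^ 2

lemma cross_iff (x y : V) (h : x ≠ y) (R : Finset V) :
    (R ∩ {x, y}).card = 1 ↔ ((x ∈ R ∧ y ∉ R) ∨ (x ∉ R ∧ y ∈ R)) := by
  by_cases hx : x ∈ R <;> by_cases hy : y ∈ R <;>
    simp [Finset.inter_insert_of_mem, Finset.inter_insert_of_notMem, Finset.inter_singleton_of_mem,
      Finset.inter_singleton_of_notMem, hx, hy, h]

lemma kap_not_cross {r : ℕ} (a b : Fin r → V) (hab : ∀ j, a j ≠ b j) (R : Finset V)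
    (h : ¬ ∀ i, (R ∩ {a i, b i}).card = 1) : kap a b R = 0 := by
  push Not at h
  obtain ⟨i, hi⟩ := h
  refine Finset.prod_eq_zero (mem_univ i) ?_
  rw [Ne, cross_iff _ _ (hab i)] at hi
  by_cases hx : a i ∈ R <;> by_cases hy : b i ∈ R <;> simp_all

lemma kap_cross {r : ℕ} (a b : Fin r → V) (hab : ∀ j, a j ≠ b j) (hb : Function.Injective b) (R : Finset V)
    (h : ∀ i, (R ∩ {a i, b i}).card = 1) : kap a b R = (-1) ^ (R ∩ Finset.image b Finset.univ).card := by
  have h1 : (R ∩ Finset.image b Finset.univ) = (univ.filter fun j => b j ∈ R).image b := by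
    ext v
    simp only [mem_inter, mem_image, mem_univ, true_and, mem_filter]
    constructor
    · rintro ⟨h1, j, rfl⟩; exact ⟨j, h1, rfl⟩
    · rintro ⟨j, h1, rfl⟩; exact ⟨h1, j, rfl⟩
  rw [h1, Finset.card_image_of_injective _ hb, ← Finset.prod_const, Finset.prod_filter]
  refine Finset.prod_congr rfl fun j _ => ?_
  have := h j
  rw [cross_iff _ _ (hab j)] at this
  rcases this with ⟨h1, h2⟩ | ⟨h1, h2⟩ <;> simp [h1, h2]

lemma signedAvg_eq (k : ℕ) {r : ℕ} (f : Finset V → ℝ) (a b : Fin r → V)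
    (hinj : Function.Injective (Sum.elim a b)) : signedAvg k f a b = ksum k f a b / kcnt k a b := by
  have hab : ∀ j, a j ≠ b j := fun j h => by
    have := @hinj (Sum.inl j) (Sum.inr j) h
    simp at this
  have hb : Function.Injective b := fun i j h => by
    have := @hinj (Sum.inr i) (Sum.inr j) h
    simpa using this
  unfold signedAvg ksum kcnt
  congr 1
  · rw [Finset.sum_filter]
    refine Finset.sum_congr rfl fun R _ => ?_
    split_ifs with h
    · rw [kap_cross a b hab hb R h]
    · rw [kap_not_cross a b hab R h, zero_mul]
  · rw [Finset.card_filter]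
    push_cast
    refine Finset.sum_congr rfl fun R _ => ?_
    split_ifs with h
    · rw [kap_cross a b hab hb R h, ← pow_mul, mul_comm, pow_mul]; simp
    · rw [kap_not_cross a b hab R h]; simp

lemma kap_abs_eq_sq {r : ℕ} (a b : Fin r → V) (R : Finset V) : |kap a b R| = kap a b R ^ 2 := by
  unfold kap
  rw [Finset.abs_prod, ← Finset.prod_pow]
  refine Finset.prod_congr rfl fun j _ => ?_
  split_ifs <;> simp

lemma kap_perm {r : ℕ} (a b : Fin r → V) (R : Finset V) (σ : Equiv.Perm V) :
    kap (σ ∘ a) (σ ∘ b) (R.image σ) = kap a b R := by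
  unfold kap
  refine Finset.prod_congr rfl fun j _ => ?_
  simp

lemma sum_perm (k : ℕ) (σ : Equiv.Perm V) (F : Finset V → ℝ) :
    ∑ R ∈ (univ : Finset V).powersetCard k, F (R.image σ) = ∑ R ∈ (univ : Finset V).powersetCard k, F R := by
  refine Finset.sum_nbij' (fun R => R.image σ) (fun R => R.image σ.symm) ?_ ?_ ?_ ?_ ?_
  · intro R hR
    rw [mem_powersetCard] at hR ⊢
    exact ⟨subset_univ _, by rw [card_image_of_injective _ σ.injective]; exact hR.2⟩
  · intro R hR
    rw [mem_powersetCard] at hR ⊢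
    exact ⟨subset_univ _, by rw [card_image_of_injective _ σ.symm.injective]; exact hR.2⟩
  · intro R _; simp [image_image]
  · intro R _; simp [image_image]
  · intro R _; rfl

lemma kcnt_perm (k : ℕ) {r : ℕ} (a b : Fin r → V) (σ : Equiv.Perm V) :
    kcnt k (σ ∘ a) (σ ∘ b) = kcnt k a b := by
  unfold kcnt
  rw [← sum_perm k σ]
  simp_rw [kap_perm]

lemma ksum_perm (k : ℕ) {r : ℕ} (f : Finset V → ℝ) (a b : Fin r → V) (σ : Equiv.Perm V) :
    ksum k f (σ ∘ a) (σ ∘ b) = ∑ R ∈ (univ : Finset V).powersetCard k, kap a b R * f (R.image σ) := by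
  unfold ksum
  rw [← sum_perm k σ]
  simp_rw [kap_perm]

lemma kap_swap {r : ℕ} (a b a' b' : Fin r → V) (θ : Fin r → ℝ)
    (h : ∀ j, (a' j = a j ∧ b' j = b j ∧ θ j = 1) ∨ (a' j = b j ∧ b' j = a j ∧ θ j = -1)) (R : Finset V) :
    kap a' b' R = (∏ j, θ j) * kap a b R := by
  unfold kap
  rw [← Finset.prod_mul_distrib]
  refine Finset.prod_congr rfl fun j _ => ?_
  rcases h j with ⟨h1, h2, h3⟩ | ⟨h1, h2, h3⟩ <;> rw [h1, h2, h3] <;> ring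

lemma ksum_swap (k : ℕ) {r : ℕ} (f : Finset V → ℝ) (a b a' b' : Fin r → V) (θ : Fin r → ℝ)
    (h : ∀ j, (a' j = a j ∧ b' j = b j ∧ θ j = 1) ∨ (a' j = b j ∧ b' j = a j ∧ θ j = -1)) :
    ksum k f a' b' = (∏ j, θ j) * ksum k f a b := by
  unfold ksum
  rw [Finset.mul_sum]
  refine Finset.sum_congr rfl fun R _ => ?_
  rw [kap_swap a b a' b' θ h]; ring

lemma perm_ext_on (s : Finset V) (f : V → V) (hf : Set.InjOn f s) :
    ∃ ρ : Equiv.Perm V, ∀ v ∈ s, ρ v = f v := by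
  obtain ⟨g, hg⟩ := Finset.exists_equiv_extend_of_card_eq (α := V) (β := V) (t := univ) (s := s) (f := f)
    (by simp) (subset_univ _) hf
  exact ⟨g.trans (Equiv.subtypeUnivEquiv (by simp)), fun v hv => by simpa using hg v hv⟩

lemma perm_ext {ι : Type*} [Fintype ι] (x x' : ι → V) (hx : Function.Injective x)
    (hx' : Function.Injective x') : ∃ ρ : Equiv.Perm V, ∀ i, ρ (x i) = x' i := by
  obtain ⟨ρ, h⟩ := perm_ext_on (univ.image x) (Function.extend x x' id) (by
    intro u hu v hv h
    simp only [coe_image, coe_univ, Set.image_univ, Set.mem_range] at hu hv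
    obtain ⟨i, rfl⟩ := hu
    obtain ⟨j, rfl⟩ := hv
    rw [hx.extend_apply, hx.extend_apply] at h
    rw [hx' h])
  exact ⟨ρ, fun i => by rw [h _ (by simp), hx.extend_apply]⟩

lemma perm_ext_set {ι : Type*} [Fintype ι] (x x' : ι → V) (hx : Function.Injective x)
    (hx' : Function.Injective x') (R R' : Finset V) (hc : #R = #R') (hR : ∀ i, x i ∈ R ↔ x' i ∈ R') :
    ∃ ρ : Equiv.Perm V, (∀ i, ρ (x i) = x' i) ∧ R.image ρ = R' := by
  obtain ⟨ρ, hρ⟩ := perm_ext x x' hx hx'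
  set R1 := R.image ρ with hR1
  have hc1 : #R1 = #R' := by rw [hR1, card_image_of_injective _ ρ.injective, hc]
  have hcd : #(R1 \ R') = #(R' \ R1) := by
    have h1 := Finset.card_sdiff_add_card_inter R1 R'
    have h2 := Finset.card_sdiff_add_card_inter R' R1
    rw [inter_comm] at h2
    omega
  have hmem : ∀ i, x' i ∈ R1 ↔ x' i ∈ R' := by
    intro i
    rw [← hR i, hR1, ← hρ i]
    simp
  obtain ⟨e⟩ : Nonempty ((R1 \ R' : Finset V) ≃ (R' \ R1 : Finset V)) := ⟨Finset.equivOfCardEq hcd⟩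
  let F : V → V := fun v => if h : v ∈ R1 \ R' then (e ⟨v, h⟩ : V) else v
  have hF1 : ∀ v (h : v ∈ R1 \ R'), F v = (e ⟨v, h⟩ : V) := fun v h => by simp only [F, dif_pos h]
  have hF2 : ∀ v, v ∉ R1 \ R' → F v = v := fun v h => by simp only [F, dif_neg h]
  have hF3 : ∀ v, v ∈ R1 \ R' → F v ∈ R' \ R1 := fun v h => by rw [hF1 v h]; exact (e ⟨v, h⟩).2
  obtain ⟨τ, hτ⟩ := perm_ext_on (univ.image x' ∪ R1) F (by
    have key : ∀ v ∈ univ.image x' ∪ R1, v ∉ R' \ R1 := by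
      intro v hv h
      rw [mem_sdiff] at h
      rw [mem_union] at hv
      rcases hv with hv | hv
      · obtain ⟨i, _, rfl⟩ := mem_image.mp hv
        exact h.2 ((hmem i).mpr h.1)
      · exact h.2 hv
    intro u hu v hv h
    by_cases hu1 : u ∈ R1 \ R' <;> by_cases hv1 : v ∈ R1 \ R'
    · rw [hF1 u hu1, hF1 v hv1] at h
      have := e.injective (Subtype.ext h)
      simpa using this
    · rw [hF2 v hv1] at h
      exact absurd (h ▸ hF3 u hu1) (key v hv)
    · rw [hF2 u hu1] at h
      exact absurd (h ▸ hF3 v hv1) (key u hu)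
    · rwa [hF2 u hu1, hF2 v hv1] at h)
  refine ⟨ρ.trans τ, fun i => ?_, ?_⟩
  · rw [Equiv.trans_apply, hρ i, hτ _ (by simp), hF2]
    rw [mem_sdiff, hmem i]; tauto
  · have h1 : R.image (ρ.trans τ) = R1.image τ := by
      rw [hR1, image_image]; rfl
    rw [h1]
    refine Finset.eq_of_subset_of_card_le ?_ ?_
    · intro v hv
      obtain ⟨u, hu, rfl⟩ := mem_image.mp hv
      rw [hτ u (mem_union_right _ hu)]
      by_cases hu1 : u ∈ R1 \ R'
      · exact (mem_sdiff.mp (hF3 u hu1)).1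
      · rw [hF2 u hu1]
        rw [mem_sdiff] at hu1
        tauto
    · rw [card_image_of_injective _ τ.injective, hc1]

/-- the averaged function -/
noncomputable def alph (k : ℕ) {r : ℕ} (f : Finset V → ℝ) (a b : Fin r → V) (R : Finset V) : ℝ :=
  ∑ σ : Equiv.Perm V, f (R.image σ) * ksum k f (σ ∘ a) (σ ∘ b)

lemma alph_perm (k : ℕ) {r : ℕ} (f : Finset V → ℝ) (a b : Fin r → V) (R : Finset V) (ρ : Equiv.Perm V)
    (θ : Fin r → ℝ)
    (h : ∀ j, (ρ (a j) = a j ∧ ρ (b j) = b j ∧ θ j = 1) ∨ (ρ (a j) = b j ∧ ρ (b j) = a j ∧ θ j = -1)) :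
    alph k f a b R = (∏ j, θ j) * alph k f a b (R.image ρ) := by
  unfold alph
  rw [← Equiv.sum_comp (Equiv.mulRight ρ), Finset.mul_sum]
  refine Finset.sum_congr rfl fun σ _ => ?_
  have h1 : R.image (Equiv.mulRight ρ σ) = (R.image ρ).image σ := by
    rw [image_image]; rfl
  rw [h1, ksum_swap k f (σ ∘ a) (σ ∘ b) ((Equiv.mulRight ρ σ) ∘ a) ((Equiv.mulRight ρ σ) ∘ b) θ]
  · ring
  · intro j
    simp only [Function.comp, Equiv.coe_mulRight, Equiv.Perm.mul_apply]
    rcases h j with ⟨h1, h2, h3⟩ | ⟨h1, h2, h3⟩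
    · left; rw [h1, h2]; exact ⟨rfl, rfl, h3⟩
    · right; rw [h1, h2]; exact ⟨rfl, rfl, h3⟩

lemma alph_not_cross (k : ℕ) {r : ℕ} (f : Finset V → ℝ) (a b : Fin r → V)
    (hinj : Function.Injective (Sum.elim a b)) (R : Finset V) (j : Fin r) (hj : a j ∈ R ↔ b j ∈ R) :
    alph k f a b R = 0 := by
  have hsep : ∀ i, i ≠ j → a i ≠ a j ∧ a i ≠ b j ∧ b i ≠ a j ∧ b i ≠ b j := by
    intro i hij
    refine ⟨fun h => ?_, fun h => ?_, fun h => ?_, fun h => ?_⟩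
    · exact hij (by simpa using @hinj (Sum.inl i) (Sum.inl j) h)
    · simpa using @hinj (Sum.inl i) (Sum.inr j) h
    · simpa using @hinj (Sum.inr i) (Sum.inl j) h
    · exact hij (by simpa using @hinj (Sum.inr i) (Sum.inr j) h)
  have h := alph_perm k f a b R (Equiv.swap (a j) (b j)) (fun i => if i = j then -1 else 1) (by
    intro i
    by_cases hij : i = j
    · subst hij; right; simp
    · left
      obtain ⟨h1, h2, h3, h4⟩ := hsep i hij
      simp [Equiv.swap_apply_of_ne_of_ne, h1, h2, h3, h4, hij])
  have h2 : R.image (Equiv.swap (a j) (b j)) = R := by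
    ext v
    simp only [mem_image]
    constructor
    · rintro ⟨u, hu, rfl⟩
      rw [Equiv.swap_apply_def]
      split_ifs with h1 h2
      · subst h1; exact hj.mp hu
      · subst h2; exact hj.mpr hu
      · exact hu
    · intro hv
      refine ⟨Equiv.swap (a j) (b j) v, ?_, Equiv.swap_apply_self _ _ _⟩
      rw [Equiv.swap_apply_def]
      split_ifs with h1 h2
      · subst h1; exact hj.mp hv
      · subst h2; exact hj.mpr hv
      · exact hv
  rw [h2, Finset.prod_ite_eq'] at h
  simp at h
  linarith

lemma alph_prop (k : ℕ) {r : ℕ} (f : Finset V → ℝ) (a b : Fin r → V)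
    (hinj : Function.Injective (Sum.elim a b)) (R R' : Finset V) (hR : #R = k) (hR' : #R' = k) :
    kap a b R' ^ 2 * alph k f a b R = kap a b R * (kap a b R' * alph k f a b R') := by
  by_cases h1 : ∃ j, a j ∈ R ↔ b j ∈ R
  · obtain ⟨j, hj⟩ := h1
    have : kap a b R = 0 := Finset.prod_eq_zero (mem_univ j) (by simp [hj])
    rw [alph_not_cross k f a b hinj R j hj, this]; ring
  by_cases h2 : ∃ j, a j ∈ R' ↔ b j ∈ R'
  · obtain ⟨j, hj⟩ := h2
    have : kap a b R' = 0 := Finset.prod_eq_zero (mem_univ j) (by simp [hj])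
    rw [this]; ring
  push Not at h1 h2
  have e1 : ∀ i j, a i = a j → i = j := fun i j h => by simpa using @hinj (Sum.inl i) (Sum.inl j) h
  have e2 : ∀ i j, b i = b j → i = j := fun i j h => by simpa using @hinj (Sum.inr i) (Sum.inr j) h
  have e3 : ∀ i j, a i ≠ b j := fun i j h => by simpa using @hinj (Sum.inl i) (Sum.inr j) h
  classical
  let a' : Fin r → V := fun j => if (a j ∈ R ↔ a j ∈ R') then a j else b j
  let b' : Fin r → V := fun j => if (a j ∈ R ↔ a j ∈ R') then b j else a j
  have hinj' : Function.Injective (Sum.elim a' b') := by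
    rintro (i | i) (j | j) h <;> simp only [Sum.elim_inl, Sum.elim_inr, a', b'] at h <;> split_ifs at h <;>
      grind
  obtain ⟨ρ, hρ, hρR⟩ := perm_ext_set (Sum.elim a b) (Sum.elim a' b') hinj hinj' R R' (hR.trans hR'.symm) (by
    rintro (j | j) <;> simp only [Sum.elim_inl, Sum.elim_inr, a', b'] <;> grind)
  have h := alph_perm k f a b R ρ
    (fun j => if (a j ∈ R ↔ a j ∈ R') then 1 else -1) (by
    intro j
    have p1 := hρ (Sum.inl j)
    have p2 := hρ (Sum.inr j)
    simp only [Sum.elim_inl, Sum.elim_inr, a', b'] at p1 p2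
    by_cases h : (a j ∈ R ↔ a j ∈ R')
    · left; simp only [h, if_true] at p1 p2 ⊢; exact ⟨p1, p2, trivial⟩
    · right; simp only [h, if_false] at p1 p2 ⊢; exact ⟨p1, p2, trivial⟩)
  have hθ : kap a b R' * (∏ j, if (a j ∈ R ↔ a j ∈ R') then (1:ℝ) else -1) = kap a b R := by
    unfold kap
    rw [← Finset.prod_mul_distrib]
    refine Finset.prod_congr rfl fun j _ => ?_
    have q1 := h1 j
    have q2 := h2 j
    by_cases x1 : a j ∈ R <;> by_cases x2 : b j ∈ R <;> by_cases x3 : a j ∈ R' <;> by_cases x4 : b j ∈ R' <;>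
      simp_all
  rw [hρR] at h
  rw [h, ← hθ]; ring

lemma alph_eq (k : ℕ) {r : ℕ} (f : Finset V → ℝ) (a b : Fin r → V)
    (hinj : Function.Injective (Sum.elim a b)) (R : Finset V) (hR : #R = k) :
    kcnt k a b * alph k f a b R = kap a b R * ∑ σ : Equiv.Perm V, ksum k f (σ ∘ a) (σ ∘ b) ^ 2 := by
  have h1 : ∑ R' ∈ (univ : Finset V).powersetCard k, kap a b R' * alph k f a b R' =
      ∑ σ : Equiv.Perm V, ksum k f (σ ∘ a) (σ ∘ b) ^ 2 := by
    unfold alph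
    simp_rw [Finset.mul_sum]
    rw [Finset.sum_comm]
    refine Finset.sum_congr rfl fun σ _ => ?_
    rw [sq]
    nth_rw 2 [ksum_perm]
    rw [Finset.sum_mul]
    refine Finset.sum_congr rfl fun R' _ => by ring
  rw [← h1, kcnt, Finset.sum_mul, Finset.mul_sum]
  refine Finset.sum_congr rfl fun R' hR' => ?_
  exact alph_prop k f a b hinj R R' hR (mem_powersetCard.mp hR').2

lemma alph_sum (k : ℕ) {r : ℕ} (f h : Finset V → ℝ) (a b : Fin r → V)
    (hinj : Function.Injective (Sum.elim a b)) :
    kcnt k a b ^ 2 * ∑ R ∈ (univ : Finset V).powersetCard k, alph k f a b R * alph k h a b R =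
      kcnt k a b * ((∑ σ : Equiv.Perm V, ksum k f (σ ∘ a) (σ ∘ b) ^ 2) *
        (∑ σ : Equiv.Perm V, ksum k h (σ ∘ a) (σ ∘ b) ^ 2)) := by
  rw [Finset.mul_sum]
  conv_rhs => rw [kcnt, Finset.sum_mul]
  refine Finset.sum_congr rfl fun R hR => ?_
  have hR' := (mem_powersetCard.mp hR).2
  have h1 := alph_eq k f a b hinj R hR'
  have h2 := alph_eq k h a b hinj R hR'
  calc _ = (kcnt k a b * alph k f a b R) * (kcnt k a b * alph k h a b R) := by ring
    _ = _ := by rw [h1, h2]; ring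

/-- averaging over permutations is averaging over injections -/
lemma inj_avg {r : ℕ} (φ : (Fin r → V) × (Fin r → V) → ℝ) (a b : Fin r → V)
    (hinj : Function.Injective (Sum.elim a b)) :
    ((univ.filter (fun p : (Fin r → V) × (Fin r → V) => Function.Injective (Sum.elim p.1 p.2))).card : ℝ) *
      ∑ σ : Equiv.Perm V, φ (σ ∘ a, σ ∘ b) =
    Fintype.card (Equiv.Perm V) *
      ∑ p ∈ univ.filter (fun p : (Fin r → V) × (Fin r → V) => Function.Injective (Sum.elim p.1 p.2)), φ p := by
  set I := univ.filter (fun p : (Fin r → V) × (Fin r → V) => Function.Injective (Sum.elim p.1 p.2)) with hI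
  have h1 : ∀ p ∈ I, ∑ σ : Equiv.Perm V, φ (σ ∘ p.1, σ ∘ p.2) = ∑ σ : Equiv.Perm V, φ (σ ∘ a, σ ∘ b) := by
    intro p hp
    obtain ⟨ρ, hρ⟩ := perm_ext (Sum.elim a b) (Sum.elim p.1 p.2) hinj (mem_filter.mp hp).2
    rw [← Equiv.sum_comp (Equiv.mulRight ρ) (fun σ : Equiv.Perm V => φ (σ ∘ a, σ ∘ b))]
    refine Finset.sum_congr rfl fun σ _ => ?_
    congr 2
    · ext j
      have := hρ (Sum.inl j)
      simp only [Sum.elim_inl] at this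
      simp [this]
    · ext j
      have := hρ (Sum.inr j)
      simp only [Sum.elim_inr] at this
      simp [this]
  have h2 : ∀ σ : Equiv.Perm V, ∑ p ∈ I, φ (σ ∘ p.1, σ ∘ p.2) = ∑ p ∈ I, φ p := by
    intro σ
    refine Finset.sum_nbij' (fun p => (σ ∘ p.1, σ ∘ p.2)) (fun p => (σ.symm ∘ p.1, σ.symm ∘ p.2)) ?_ ?_ ?_ ?_ ?_
    · intro p hp
      rw [hI, mem_filter] at hp ⊢
      refine ⟨mem_univ _, ?_⟩
      have := σ.injective.comp hp.2
      rwa [Sum.comp_elim] at this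
    · intro p hp
      rw [hI, mem_filter] at hp ⊢
      refine ⟨mem_univ _, ?_⟩
      have := σ.symm.injective.comp hp.2
      rwa [Sum.comp_elim] at this
    · intro p _; ext <;> simp
    · intro p _; ext <;> simp
    · intro p _; rfl
  rw [← nsmul_eq_mul, ← Finset.sum_const, ← Finset.sum_congr rfl h1, Finset.sum_comm,
    Finset.sum_congr rfl fun σ _ => h2 σ, Finset.sum_const, nsmul_eq_mul, Finset.card_univ]

lemma Wpow_sq (k : ℕ) {r : ℕ} (f : Finset V → ℝ) (a b : Fin r → V)
    (hinj : Function.Injective (Sum.elim a b)) :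
    Fintype.card (Equiv.Perm V) * Wpow k r f ^ 2 = ∑ σ : Equiv.Perm V, signedAvg k f (σ ∘ a) (σ ∘ b) ^ 2 := by
  have h := inj_avg (fun p => signedAvg k f p.1 p.2 ^ 2) a b hinj
  have hpos : (0:ℝ) < ((univ.filter (fun p : (Fin r → V) × (Fin r → V) =>
      Function.Injective (Sum.elim p.1 p.2))).card : ℝ) := by
    exact_mod_cast Finset.card_pos.mpr ⟨(a, b), by simpa using hinj⟩
  unfold Wpow
  rw [Real.sq_sqrt (by positivity), ← mul_div_assoc, ← h]
  field_simp

lemma signedAvg_perm (k : ℕ) {r : ℕ} (f : Finset V → ℝ) (a b : Fin r → V)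
    (hinj : Function.Injective (Sum.elim a b)) (σ : Equiv.Perm V) :
    signedAvg k f (σ ∘ a) (σ ∘ b) = ksum k f (σ ∘ a) (σ ∘ b) / kcnt k a b := by
  rw [signedAvg_eq, kcnt_perm]
  have := σ.injective.comp hinj
  rwa [Sum.comp_elim] at this

lemma ksum_abs (k : ℕ) {r : ℕ} (f : Finset V → ℝ) (hf : ∀ R, |f R| ≤ 1) (a b : Fin r → V) :
    |ksum k f a b| ≤ kcnt k a b := by
  unfold ksum kcnt
  refine (Finset.abs_sum_le_sum_abs _ _).trans (Finset.sum_le_sum fun R _ => ?_)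
  rw [abs_mul, ← kap_abs_eq_sq]
  exact mul_le_of_le_one_right (abs_nonneg _) (hf R)

lemma kcnt_ge (k : ℕ) {r : ℕ} (hr : r ≤ k) (a b : Fin r → V)
    (hinj : Function.Injective (Sum.elim a b)) :
    ((Fintype.card V - 2 * r).choose (k - r) : ℝ) ≤ kcnt k a b := by
  have e1 : ∀ i j, a i = a j → i = j := fun i j h => by simpa using @hinj (Sum.inl i) (Sum.inl j) h
  have e3 : ∀ i j, a i ≠ b j := fun i j h => by simpa using @hinj (Sum.inl i) (Sum.inr j) h
  set U := univ.image (Sum.elim a b) with hU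
  have hUc : #U = 2 * r := by
    rw [hU, card_image_of_injective _ hinj]; simp; ring
  have haU : ∀ j, a j ∈ U := fun j => mem_image.mpr ⟨Sum.inl j, mem_univ _, rfl⟩
  have hbU : ∀ j, b j ∈ U := fun j => mem_image.mpr ⟨Sum.inr j, mem_univ _, rfl⟩
  have h1 : #((Uᶜ).powersetCard (k - r)) = (Fintype.card V - 2 * r).choose (k - r) := by
    rw [card_powersetCard, card_compl, hUc]
  have hAc : #(univ.image a) = r := by rw [card_image_of_injective _ e1]; simp
  have hAU : univ.image a ⊆ U := fun v hv => by
    obtain ⟨j, _, rfl⟩ := mem_image.mp hv; exact haU j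
  have hdisj : ∀ T ∈ (Uᶜ).powersetCard (k - r), Disjoint (univ.image a) T := by
    intro T hT
    rw [mem_powersetCard] at hT
    exact disjoint_of_subset_left hAU (disjoint_of_subset_right hT.1 disjoint_compl_right)
  rw [← h1]
  have h2 : ((Uᶜ).powersetCard (k - r)).image (fun T => univ.image a ∪ T) ⊆ (univ : Finset V).powersetCard k := by
    intro R hR
    obtain ⟨T, hT, rfl⟩ := mem_image.mp hR
    rw [mem_powersetCard]
    refine ⟨subset_univ _, ?_⟩
    rw [card_union_of_disjoint (hdisj T hT), hAc, (mem_powersetCard.mp hT).2]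
    omega
  have hinjT : Set.InjOn (fun T => univ.image a ∪ T) ((Uᶜ).powersetCard (k - r) : Set (Finset V)) := by
    intro T hT T' hT' h
    have h3 : (univ.image a ∪ T) \ univ.image a = (univ.image a ∪ T') \ univ.image a := by
      simp only at h; rw [h]
    rwa [union_sdiff_cancel_left (hdisj T hT), union_sdiff_cancel_left (hdisj T' hT')] at h3
  unfold kcnt
  refine le_trans ?_ (Finset.sum_le_sum_of_subset_of_nonneg h2 fun _ _ _ => sq_nonneg _)
  rw [Finset.sum_image hinjT]
  rw [Finset.sum_congr rfl (g := fun _ => (1:ℝ))]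
  · simp
  · intro T hT
    have : kap a b (univ.image a ∪ T) = 1 := by
      refine Finset.prod_eq_one fun j _ => ?_
      have x1 : a j ∈ univ.image a ∪ T := mem_union_left _ (mem_image_of_mem _ (mem_univ _))
      have x2 : b j ∉ univ.image a ∪ T := by
        rw [mem_union, not_or]
        refine ⟨fun h => ?_, fun h => ?_⟩
        · obtain ⟨i, _, hi⟩ := mem_image.mp h
          exact e3 _ _ hi
        · exact (mem_compl.mp ((mem_powersetCard.mp hT).1 h)) (hbU j)
      rw [if_pos x1, if_neg x2]; ring
    rw [this]; norm_num

end combi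

section flips
variable {r m n : ℕ}

/-- flipping bits on labels -/
def flipE (e : Fin r → Fin m → Bool) : Equiv.Perm (Fin r × Fin m × Bool) :=
  Function.Involutive.toPerm (fun p => (p.1, p.2.1, xor p.2.2 (e p.1 p.2.1))) (by
    rintro ⟨j, i, b⟩
    simp)

lemma flipE_apply (e : Fin r → Fin m → Bool) (p : Fin r × Fin m × Bool) :
    flipE e p = (p.1, p.2.1, xor p.2.2 (e p.1 p.2.1)) := rfl

/-- flipping pairs of vertices -/
noncomputable def tE (x : Fin r × Fin m × Bool ↪ Fin n) (e : Fin r → Fin m → Bool) : Equiv.Perm (Fin n) :=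
  (flipE e).viaEmbedding x

lemma tE_apply (x : Fin r × Fin m × Bool ↪ Fin n) (e : Fin r → Fin m → Bool) (p : Fin r × Fin m × Bool) :
    tE x e (x p) = x (p.1, p.2.1, xor p.2.2 (e p.1 p.2.1)) := by
  unfold tE
  rw [Equiv.Perm.viaEmbedding_apply, flipE_apply]

lemma tE_congr (x : Fin r × Fin m × Bool ↪ Fin n) (e e' : Fin r → Fin m → Bool) (v : Fin n)
    (h : ∀ p, x p = v → e p.1 p.2.1 = e' p.1 p.2.1) : tE x e v = tE x e' v := by
  by_cases hv : v ∈ Set.range x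
  · obtain ⟨p, rfl⟩ := hv
    rw [tE_apply, tE_apply, h p rfl]
  · unfold tE
    rw [Equiv.Perm.viaEmbedding_apply_of_notMem _ _ _ hv, Equiv.Perm.viaEmbedding_apply_of_notMem _ _ _ hv]

lemma sg_not (b : Bool) : sg (!b) = - sg b := by cases b <;> simp [sg]

lemma sum_flip_zero (i : Fin m) (A : Finset (Fin m)) (hi : i ∈ A) (g : (Fin m → Bool) → ℝ)
    (hg : ∀ d, g (Function.update d i (!(d i))) = g d) : ∑ d, g d * ∏ i ∈ A, sg (d i) = 0 := by
  let E : Equiv.Perm (Fin m → Bool) := Function.Involutive.toPerm (fun d => Function.update d i (!(d i))) (by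
    intro d; simp)
  have h := Equiv.sum_comp E (fun d => g d * ∏ i ∈ A, sg (d i))
  have h2 : ∀ d, g (E d) * ∏ i ∈ A, sg (E d i) = - (g d * ∏ i ∈ A, sg (d i)) := by
    intro d
    have : E d = Function.update d i (!(d i)) := rfl
    rw [this, hg, ← Finset.mul_prod_erase A _ hi, ← Finset.mul_prod_erase A (fun i => sg (d i)) hi]
    rw [Function.update_self, sg_not]
    rw [Finset.prod_congr rfl (g := fun i => sg (d i))]
    · ring
    · intro l hl
      rw [Function.update_of_ne (Finset.ne_of_mem_erase hl)]
  rw [Finset.sum_congr rfl fun d _ => h2 d, Finset.sum_neg_distrib] at h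
  linarith

lemma mdeg_Y {k : ℕ} (x : Fin r × Fin m × Bool ↪ Fin n) (f h : Finset (Fin n) → ℝ)
    (σ π : Equiv.Perm (Fin n)) (K : ℝ) :
    MDeg k (fun e : Fin r → Fin m → Bool =>
      ∑ R ∈ (univ : Finset (Fin n)).powersetCard k, f (R.image (σ * tE x e)) * h (R.image π) - K) := by
  intro j e A hA
  have hterm : ∀ R ∈ (univ : Finset (Fin n)).powersetCard k,
      ∑ d : Fin m → Bool, (f (R.image (σ * tE x (Function.update e j d))) * h (R.image π)) *
        ∏ i ∈ A, sg (d i) = 0 := by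
    intro R hR
    have hRc := (mem_powersetCard.mp hR).2
    obtain ⟨i, hi, hiR⟩ : ∃ i ∈ A, ∀ b, x (j, i, b) ∉ R := by
      by_contra hcon
      push Not at hcon
      choose! b hb using hcon
      have : #A ≤ #R := Finset.card_le_card_of_injOn (fun i => x (j, i, b i)) (fun i hi => hb i hi) (by
        intro i _ i' _ hii
        have := x.injective hii
        simp only [Prod.mk.injEq] at this
        exact this.2.1)
      omega
    refine sum_flip_zero i A hi _ fun d => ?_
    congr 2
    refine Finset.image_congr fun v hv => ?_
    simp only [Equiv.Perm.mul_apply]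
    congr 1
    refine tE_congr x _ _ v fun p hp => ?_
    obtain ⟨j', i', b'⟩ := p
    simp only
    by_cases hj : j' = j
    · subst hj
      rw [Function.update_self, Function.update_self, Function.update_of_ne]
      rintro rfl
      rw [← hp] at hv
      exact hiR b' hv
    · rw [Function.update_of_ne hj, Function.update_of_ne hj]
  have hK : ∑ d : Fin m → Bool, K * ∏ i ∈ A, sg (d i) = 0 := by
    obtain ⟨i, hi⟩ : A.Nonempty := Finset.card_pos.mp (by omega)
    exact sum_flip_zero i A hi (fun _ => K) fun _ => rfl
  simp_rw [sub_mul, Finset.sum_sub_distrib, hK, Finset.sum_mul]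
  rw [Finset.sum_comm, Finset.sum_eq_zero hterm, sub_zero]

lemma main_coef {k : ℕ} (s : ℕ) (x : Fin (s+1) × Fin m × Bool ↪ Fin n) (f h : Finset (Fin n) → ℝ) (K : ℝ)
    (i : Fin (s+1) → Fin m) (a b : Fin (s+1) → Fin n) (ha : ∀ j, a j = x (j, i j, false))
    (hb : ∀ j, b j = x (j, i j, true)) (hinj : Function.Injective (Sum.elim a b)) (hpos : 0 < kcnt k a b) :
    ∑ σ : Equiv.Perm (Fin n), ∑ π : Equiv.Perm (Fin n),
      (∑ e : Fin (s+1) → Fin m → Bool,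
        (∑ R ∈ (univ : Finset (Fin n)).powersetCard k, f (R.image (σ * tE x e)) * h (R.image π) - K) *
          ∏ j, sg (e j (i j))) * (signedAvg k f (σ ∘ a) (σ ∘ b) * signedAvg k h (π ∘ a) (π ∘ b)) =
    Fintype.card (Fin (s+1) → Fin m → Bool) * (kcnt k a b *
      ((∑ σ : Equiv.Perm (Fin n), signedAvg k f (σ ∘ a) (σ ∘ b) ^ 2) *
        ∑ π : Equiv.Perm (Fin n), signedAvg k h (π ∘ a) (π ∘ b) ^ 2)) := by
  have hu : ∀ (e : Fin (s+1) → Fin m → Bool) (σ : Equiv.Perm (Fin n)),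
      signedAvg k f ((σ * tE x e : Equiv.Perm (Fin n)) ∘ a) ((σ * tE x e : Equiv.Perm (Fin n)) ∘ b) =
      (∏ j, sg (e j (i j))) * signedAvg k f (σ ∘ a) (σ ∘ b) := by
    intro e σ
    rw [signedAvg_perm k f a b hinj, signedAvg_perm k f a b hinj, ← mul_div_assoc]
    congr 1
    refine ksum_swap k f _ _ _ _ _ fun j => ?_
    simp only [Function.comp, Equiv.Perm.mul_apply, ha, hb, tE_apply]
    cases e j (i j) <;> simp [sg]
  have hu0 : ∑ σ : Equiv.Perm (Fin n), signedAvg k f (σ ∘ a) (σ ∘ b) = 0 := by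
    let e : Fin (s+1) → Fin m → Bool := fun j _ => if j = 0 then true else false
    have h1 := Equiv.sum_comp (Equiv.mulRight (tE x e))
      (fun σ : Equiv.Perm (Fin n) => signedAvg k f (σ ∘ a) (σ ∘ b))
    simp only [Equiv.coe_mulRight] at h1
    rw [Finset.sum_congr rfl fun σ _ => hu e σ, ← Finset.mul_sum] at h1
    have h2 : ∏ j, sg (e j (i j)) = -1 := by
      rw [Fin.prod_univ_succ]
      simp [e, sg]
    rw [h2] at h1
    linarith
  set Z := ∑ σ : Equiv.Perm (Fin n), ∑ π : Equiv.Perm (Fin n),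
      (∑ R ∈ (univ : Finset (Fin n)).powersetCard k, f (R.image σ) * h (R.image π) - K) *
        (signedAvg k f (σ ∘ a) (σ ∘ b) * signedAvg k h (π ∘ a) (π ∘ b)) with hZ
  have hstep : ∀ e : Fin (s+1) → Fin m → Bool, ∑ σ : Equiv.Perm (Fin n), ∑ π : Equiv.Perm (Fin n),
      (∑ R ∈ (univ : Finset (Fin n)).powersetCard k, f (R.image (σ * tE x e)) * h (R.image π) - K) *
          (∏ j, sg (e j (i j))) * (signedAvg k f (σ ∘ a) (σ ∘ b) * signedAvg k h (π ∘ a) (π ∘ b)) = Z := by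
    intro e
    rw [eq_comm, hZ, ← Equiv.sum_comp (Equiv.mulRight (tE x e))]
    refine Finset.sum_congr rfl fun σ _ => Finset.sum_congr rfl fun π _ => ?_
    simp only [Equiv.coe_mulRight]
    rw [hu e σ]
    ring
  have hL : ∑ σ : Equiv.Perm (Fin n), ∑ π : Equiv.Perm (Fin n),
      (∑ e : Fin (s+1) → Fin m → Bool,
        (∑ R ∈ (univ : Finset (Fin n)).powersetCard k, f (R.image (σ * tE x e)) * h (R.image π) - K) *
          ∏ j, sg (e j (i j))) * (signedAvg k f (σ ∘ a) (σ ∘ b) * signedAvg k h (π ∘ a) (π ∘ b)) =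
      ∑ e : Fin (s+1) → Fin m → Bool, Z := by
    rw [← Finset.sum_congr rfl fun e _ => hstep e]
    conv_rhs => rw [Finset.sum_comm]
    refine Finset.sum_congr rfl fun σ _ => ?_
    conv_rhs => rw [Finset.sum_comm]
    refine Finset.sum_congr rfl fun π _ => ?_
    rw [Finset.sum_mul]
  rw [hL, Finset.sum_const, nsmul_eq_mul, Finset.card_univ]
  congr 1
  have hal : ∀ (f : Finset (Fin n) → ℝ) R, ∑ σ : Equiv.Perm (Fin n), f (R.image σ) * signedAvg k f (σ ∘ a) (σ ∘ b) =
      alph k f a b R / kcnt k a b := by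
    intro f R
    unfold alph
    rw [Finset.sum_div]
    refine Finset.sum_congr rfl fun σ _ => ?_
    rw [signedAvg_perm k f a b hinj]; ring
  have hsq : ∀ (f : Finset (Fin n) → ℝ), ∑ σ : Equiv.Perm (Fin n), signedAvg k f (σ ∘ a) (σ ∘ b) ^ 2 =
      (∑ σ : Equiv.Perm (Fin n), ksum k f (σ ∘ a) (σ ∘ b) ^ 2) / kcnt k a b ^ 2 := by
    intro f
    rw [Finset.sum_div]
    refine Finset.sum_congr rfl fun σ _ => ?_
    rw [signedAvg_perm k f a b hinj, div_pow]
  have hZ2 : Z = ∑ R ∈ (univ : Finset (Fin n)).powersetCard k,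
      (∑ σ : Equiv.Perm (Fin n), f (R.image σ) * signedAvg k f (σ ∘ a) (σ ∘ b)) *
      (∑ π : Equiv.Perm (Fin n), h (R.image π) * signedAvg k h (π ∘ a) (π ∘ b)) -
      K * ((∑ σ : Equiv.Perm (Fin n), signedAvg k f (σ ∘ a) (σ ∘ b)) *
        ∑ π : Equiv.Perm (Fin n), signedAvg k h (π ∘ a) (π ∘ b)) := by
    simp_rw [hZ, sub_mul, Finset.sum_sub_distrib, Finset.sum_mul_sum, Finset.mul_sum, Finset.sum_mul]
    congr 1
    conv_rhs => rw [Finset.sum_comm]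
    refine Finset.sum_congr rfl fun σ _ => ?_
    rw [Finset.sum_comm]
    refine Finset.sum_congr rfl fun R _ => Finset.sum_congr rfl fun π _ => by ring
  rw [hZ2, hu0, hsq, hsq]
  have h1 := alph_sum k f h a b hinj
  have h2 : ∑ R ∈ (univ : Finset (Fin n)).powersetCard k, alph k f a b R * alph k h a b R =
      ((∑ σ : Equiv.Perm (Fin n), ksum k f (σ ∘ a) (σ ∘ b) ^ 2) *
        (∑ σ : Equiv.Perm (Fin n), ksum k h (σ ∘ a) (σ ∘ b) ^ 2)) / kcnt k a b := by
    rw [eq_div_iff hpos.ne']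
    have := mul_left_cancel₀ hpos.ne' ((by rw [← h1]; ring :
      kcnt k a b * (kcnt k a b * ∑ R ∈ (univ : Finset (Fin n)).powersetCard k, alph k f a b R * alph k h a b R) = _))
    rw [← this]; ring
  have h3 : ∀ R ∈ (univ : Finset (Fin n)).powersetCard k,
      (∑ σ : Equiv.Perm (Fin n), f (R.image σ) * signedAvg k f (σ ∘ a) (σ ∘ b)) *
      (∑ π : Equiv.Perm (Fin n), h (R.image π) * signedAvg k h (π ∘ a) (π ∘ b)) =
      (alph k f a b R * alph k h a b R) / kcnt k a b ^ 2 := by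
    intro R _
    rw [hal f R, hal h R]; field_simp
  rw [Finset.sum_congr rfl h3, ← Finset.sum_div, h2]
  field_simp
  ring

end flips

lemma main_ineq {n m k s : ℕ} (hs : s + 1 ≤ k) (hnk : 2 * k ≤ n) (hm : (s+1) * (m * 2) ≤ n)
    (f h : Finset (Fin n) → ℝ) (hf : ∀ R, |f R| ≤ 1) (hh : ∀ R, |h R| ≤ 1) (K D B C : ℝ)
    (hD : ∀ σ π : Equiv.Perm (Fin n),
      |∑ R ∈ (univ : Finset (Fin n)).powersetCard k, f (R.image σ) * h (R.image π) - K| ≤ D)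
    (hB : 0 ≤ B)
    (hb : ∀ g : (Fin m → Bool) → ℝ, DegLE k g → ∑ i, |∑ e, g e * sg (e i)| ≤ B * ∑ e, |g e|)
    (hc : ∀ (g : (Fin m → Bool) → ℝ), DegLE k g → ∀ D : ℝ, (∀ e, |g e| ≤ D) →
      ∑ i, |∑ e, g e * sg (e i)| ≤ C * (2 ^ m * D)) :
    (m : ℝ) ^ (s+1) * (((n - 2 * (s+1)).choose (k - (s+1)) : ℝ) *
      (Wpow k (s+1) f ^ 2 * Wpow k (s+1) h ^ 2)) ≤ B ^ s * C * D := by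
  obtain ⟨x⟩ : Nonempty (Fin (s+1) × Fin m × Bool ↪ Fin n) :=
    Function.Embedding.nonempty_of_card_le (by simpa using hm)
  let a : (Fin (s+1) → Fin m) → Fin (s+1) → Fin n := fun i j => x (j, i j, false)
  let b : (Fin (s+1) → Fin m) → Fin (s+1) → Fin n := fun i j => x (j, i j, true)
  have hinj : ∀ i, Function.Injective (Sum.elim (a i) (b i)) := by
    rintro i (j | j) (j' | j') hj <;> simp only [Sum.elim_inl, Sum.elim_inr, a, b] at hj <;>
      have := x.injective hj <;> simp at this <;> simp [this]
  have hq : ∀ i, ((n - 2 * (s+1)).choose (k - (s+1)) : ℝ) ≤ kcnt k (a i) (b i) := fun i => by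
    have := kcnt_ge k hs (a i) (b i) (hinj i)
    rwa [Fintype.card_fin] at this
  have hq0 : (0:ℝ) < ((n - 2 * (s+1)).choose (k - (s+1)) : ℝ) := by
    exact_mod_cast Nat.choose_pos (by omega)
  set P : ℝ := ((Fintype.card (Equiv.Perm (Fin n)) : ℕ) : ℝ) with hP
  have hP0 : 0 < P := by rw [hP]; exact_mod_cast Fintype.card_pos
  set N : ℝ := ((Fintype.card (Fin (s+1) → Fin m → Bool) : ℕ) : ℝ) with hN
  have hN0 : 0 < N := by rw [hN]; exact_mod_cast Fintype.card_pos
  have hle1 : ∀ (f : Finset (Fin n) → ℝ), (∀ R, |f R| ≤ 1) → ∀ i (σ : Equiv.Perm (Fin n)),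
      |signedAvg k f (σ ∘ a i) (σ ∘ b i)| ≤ 1 := by
    intro f hf i σ
    have h0 : 0 < kcnt k (a i) (b i) := hq0.trans_le (hq i)
    rw [signedAvg_perm k f _ _ (hinj i), abs_div, abs_of_pos h0, div_le_one h0, ← kcnt_perm k _ _ σ]
    exact ksum_abs k f hf _ _
  let Y : Equiv.Perm (Fin n) → Equiv.Perm (Fin n) → (Fin (s+1) → Fin m → Bool) → ℝ := fun σ π e =>
    ∑ R ∈ (univ : Finset (Fin n)).powersetCard k, f (R.image (σ * tE x e)) * h (R.image π) - K
  have hlow : ∀ i : Fin (s+1) → Fin m, ∑ σ : Equiv.Perm (Fin n), ∑ π : Equiv.Perm (Fin n),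
      (∑ e, Y σ π e * ∏ j, sg (e j (i j))) *
        (signedAvg k f (σ ∘ a i) (σ ∘ b i) * signedAvg k h (π ∘ a i) (π ∘ b i)) ≥
      N * (((n - 2 * (s+1)).choose (k - (s+1)) : ℝ) * ((P * Wpow k (s+1) f ^ 2) * (P * Wpow k (s+1) h ^ 2))) := by
    intro i
    have := main_coef (k := k) s x f h K i (a i) (b i) (fun _ => rfl) (fun _ => rfl) (hinj i) (hq0.trans_le (hq i))
    rw [← Wpow_sq k f (a i) (b i) (hinj i), ← Wpow_sq k h (a i) (b i) (hinj i)] at this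
    rw [ge_iff_le, this]
    refine mul_le_mul_of_nonneg_left ?_ hN0.le
    exact mul_le_mul_of_nonneg_right (hq i) (by positivity)
  have hup : ∀ σ π : Equiv.Perm (Fin n), ∑ i : Fin (s+1) → Fin m,
      (∑ e, Y σ π e * ∏ j, sg (e j (i j))) *
        (signedAvg k f (σ ∘ a i) (σ ∘ b i) * signedAvg k h (π ∘ a i) (π ∘ b i)) ≤ B ^ s * C * D * N := by
    intro σ π
    refine le_trans (Finset.sum_le_sum fun i _ => ?_)
      (multi_sup B C hB hb hc s (Y σ π) (mdeg_Y x f h σ π K) D fun e => hD _ _)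
    refine (le_abs_self _).trans ?_
    rw [abs_mul, abs_mul]
    exact mul_le_of_le_one_right (abs_nonneg _)
      (mul_le_one₀ (hle1 f hf i σ) (abs_nonneg _) (hle1 h hh i π))
  have h1 : ∑ i : Fin (s+1) → Fin m,
      N * (((n - 2 * (s+1)).choose (k - (s+1)) : ℝ) * ((P * Wpow k (s+1) f ^ 2) * (P * Wpow k (s+1) h ^ 2))) ≤
      ∑ σ : Equiv.Perm (Fin n), ∑ π : Equiv.Perm (Fin n), B ^ s * C * D * N := by
    refine (Finset.sum_le_sum fun i _ => hlow i).trans ?_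
    rw [Finset.sum_comm]
    refine Finset.sum_le_sum fun σ _ => ?_
    rw [Finset.sum_comm]
    exact Finset.sum_le_sum fun π _ => hup σ π
  simp only [Finset.sum_const, Finset.card_univ, nsmul_eq_mul] at h1
  rw [← hP, Fintype.card_fun, Fintype.card_fin, Fintype.card_fin] at h1
  push_cast at h1
  have h2 : 0 < N * P * P := by positivity
  refine le_of_mul_le_mul_left ?_ h2
  calc _ = _ := ?_
    _ ≤ _ := h1
    _ = _ := ?_
  · ring
  · ring

lemma inter_count {n k : ℕ} (G H : Finset (Finset (Fin n))) (hG : ∀ e ∈ G, e.card = k)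
    (σ π : Equiv.Perm (Fin n)) :
    ∑ R ∈ (univ : Finset (Fin n)).powersetCard k, hyperInd G (R.image σ) * hyperInd H (R.image π) =
      ((permEdges σ⁻¹ G ∩ permEdges π⁻¹ H).card : ℝ) := by
  have hmem : ∀ (G : Finset (Finset (Fin n))) (σ : Equiv.Perm (Fin n)) R, R ∈ permEdges σ⁻¹ G ↔ R.image σ ∈ G := by
    intro G σ R
    unfold permEdges
    rw [mem_image]
    constructor
    · rintro ⟨e, he, rfl⟩
      have : (e.image (σ⁻¹ : Equiv.Perm (Fin n))).image σ = e := by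
        rw [image_image, show (σ ∘ (σ⁻¹ : Equiv.Perm (Fin n))) = id from funext fun v => by simp, image_id]
      rwa [this]
    · intro h
      refine ⟨_, h, ?_⟩
      rw [image_image, show ((σ⁻¹ : Equiv.Perm (Fin n)) ∘ σ) = id from funext fun v => by simp, image_id]
  have : permEdges σ⁻¹ G ∩ permEdges π⁻¹ H =
      ((univ : Finset (Fin n)).powersetCard k).filter (fun R => R.image σ ∈ G ∧ R.image π ∈ H) := by
    ext R
    rw [mem_inter, hmem, hmem, mem_filter, mem_powersetCard]
    constructor
    · rintro ⟨h1, h2⟩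
      refine ⟨⟨subset_univ _, ?_⟩, h1, h2⟩
      rw [← hG _ h1, card_image_of_injective _ σ.injective]
    · exact fun h => h.2
  rw [this, Finset.card_filter]
  push_cast
  refine Finset.sum_congr rfl fun R _ => ?_
  unfold hyperInd
  split_ifs <;> simp_all

lemma final_numeric (k s n : ℕ) (hs : s + 1 ≤ k) (hn : 2 * k ≤ n) :
    √(1 / (4 * k)) ^ (k + 1) / (k.factorial : ℝ) * (n : ℝ) ^ (((k : ℝ) + 1) / 2) ≤
      √((n / (2 * (s+1)) : ℕ) : ℝ) ^ (s + 2) * ((n - 2 * (s+1)).choose (k - (s+1)) : ℝ) := by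
  have hk : (1:ℝ) ≤ k := by exact_mod_cast (show 1 ≤ k by omega)
  have hnR : 2 * (k:ℝ) ≤ n := by exact_mod_cast hn
  have hn0 : (0:ℝ) ≤ n := Nat.cast_nonneg _
  set y : ℝ := n / (4 * k) with hy
  have hy0 : 0 ≤ y := by positivity
  have h1 : √(1 / (4 * k)) ^ (k + 1) * (n : ℝ) ^ (((k : ℝ) + 1) / 2) = √y ^ (k+1) := by
    have : (n : ℝ) ^ (((k : ℝ) + 1) / 2) = √n ^ (k+1) := by
      rw [Real.sqrt_eq_rpow, ← Real.rpow_natCast, ← Real.rpow_mul hn0]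
      congr 1; push_cast; ring
    rw [this, ← mul_pow, ← Real.sqrt_mul (by positivity)]
    congr 2; rw [hy]; ring
  have hm : y ≤ ((n / (2 * (s+1)) : ℕ) : ℝ) := by
    have e1 : n < 2 * (s+1) * (n / (2 * (s+1))) + 2 * (s+1) := by
      have := Nat.lt_mul_div_succ n (show 0 < 2 * (s+1) by omega)
      linarith
    have e2 : 1 ≤ n / (2 * (s+1)) := (Nat.one_le_div_iff (by omega)).mpr (by omega)
    have e3 : n ≤ 4 * k * (n / (2 * (s+1))) := by
      generalize n / (2 * (s+1)) = q at *
      nlinarith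
    rw [hy, div_le_iff₀ (by positivity)]
    have : (n:ℝ) ≤ 4 * k * ((n / (2 * (s+1)) : ℕ) : ℝ) := by exact_mod_cast e3
    linarith
  have hc : √y ^ (k - (s+1)) / (k.factorial : ℝ) ≤ ((n - 2 * (s+1)).choose (k - (s+1)) : ℝ) := by
    refine le_trans ?_ (Nat.pow_le_choose (α := ℝ) (k - (s+1)) (n - 2 * (s+1)))
    have e1 : n - 2 * k + 1 ≤ n - 2 * (s+1) + 1 - (k - (s+1)) := by omega
    have e2 : ((n:ℝ) - 2 * k + 1) ≤ ((n - 2 * (s+1) + 1 - (k - (s+1)) : ℕ) : ℝ) := by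
      have : ((n - 2 * k + 1 : ℕ) : ℝ) ≤ ((n - 2 * (s+1) + 1 - (k - (s+1)) : ℕ) : ℝ) := by exact_mod_cast e1
      rw [Nat.cast_add, Nat.cast_sub hn] at this
      push_cast at this ⊢
      exact this
    have e3 : √y ≤ (n:ℝ) - 2 * k + 1 := by
      rw [Real.sqrt_le_left (by linarith)]
      have : y ≤ (n:ℝ) - 2 * k + 1 := by
        rw [hy, div_le_iff₀ (by positivity)]
        nlinarith
      nlinarith
    have e4 : √y ^ (k - (s+1)) ≤ (((n - 2 * (s+1) + 1 - (k - (s+1)) : ℕ)) : ℝ) ^ (k - (s+1)) :=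
      pow_le_pow_left₀ (Real.sqrt_nonneg _) (e3.trans e2) _
    have e5 : ((k - (s+1)).factorial : ℝ) ≤ k.factorial := by
      exact_mod_cast Nat.factorial_le (by omega)
    exact div_le_div₀ (by positivity) e4 (by positivity) e5
  have hsq : √y ^ (s+2) ≤ √((n / (2 * (s+1)) : ℕ) : ℝ) ^ (s + 2) :=
    pow_le_pow_left₀ (Real.sqrt_nonneg _) (Real.sqrt_le_sqrt hm) _
  calc _ = √y ^ (k+1) / k.factorial := by rw [← h1]; ring
    _ = √y ^ (s+2) * (√y ^ (k - (s+1)) / (k.factorial : ℝ)) := by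
        rw [← mul_div_assoc, ← pow_add]; congr 2; omega
    _ ≤ _ := mul_le_mul hsq hc (by positivity) (by positivity)

theorem stmt5 (k : ℕ) (hk : 1 ≤ k) :
    ∃ c : ℝ, 0 < c ∧ ∀ n : ℕ, 2 * k ≤ n →
      ∀ G H : Finset (Finset (Fin n)),
        (∀ e ∈ G, e.card = k) → (∀ e ∈ H, e.card = k) →
        ∀ r : ℕ, 1 ≤ r → r ≤ k →
          c * (n : ℝ) ^ (((k : ℝ) + 1) / 2) *
            (Wpow k r (hyperInd G) * Wpow k r (hyperInd H)) ^ 2 ≤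
          disc n k G H := by
  obtain ⟨l, t, ht, hl⟩ := nodes_exist k hk
  set C0 : ℝ := ∑ j, |l j| with hC0
  have hC00 : 0 ≤ C0 := Finset.sum_nonneg fun _ _ => abs_nonneg _
  set E0 : ℝ := (C0 + 1) * Real.exp 1 with hE0
  have hexp : 1 ≤ Real.exp 1 := Real.one_le_exp (by norm_num)
  have hE1 : 1 ≤ E0 := by rw [hE0]; nlinarith
  have hk0 : (0:ℝ) < k := by exact_mod_cast hk
  refine ⟨√(1 / (4 * k)) ^ (k + 1) / (k.factorial : ℝ) / E0 ^ k, by positivity, ?_⟩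
  intro n hn G H hG hH r hr hrk
  obtain ⟨s, rfl⟩ : ∃ s, r = s + 1 := ⟨r - 1, by omega⟩
  set D := disc n k G H with hDdef
  have hD : ∀ σ π : Equiv.Perm (Fin n),
      |∑ R ∈ (univ : Finset (Fin n)).powersetCard k, hyperInd G (R.image σ) * hyperInd H (R.image π) -
        ((G.card : ℝ) * H.card) / (n.choose k)| ≤ D := by
    intro σ π
    rw [inter_count G H hG]
    exact le_ciSup (f := fun p : Equiv.Perm (Fin n) × Equiv.Perm (Fin n) =>
      |((permEdges p.1 G ∩ permEdges p.2 H).card : ℝ) - ((G.card : ℝ) * H.card) / (n.choose k)|)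
      (Set.finite_range _).bddAbove (σ⁻¹, π⁻¹)
  have hD0 : 0 ≤ D := (abs_nonneg _).trans (hD 1 1)
  have hind : ∀ (G : Finset (Finset (Fin n))) R, |hyperInd G R| ≤ 1 := by
    intro G R
    unfold hyperInd
    split_ifs <;> simp
  set m : ℕ := n / (2 * (s+1)) with hm
  have hm1 : 1 ≤ m := (Nat.one_le_div_iff (by omega)).mpr (by omega)
  have hmn : (s+1) * (m * 2) ≤ n := by
    have := Nat.mul_div_le n (2 * (s+1))
    rw [← hm] at this
    linarith
  have hmain := main_ineq (k := k) (s := s) (m := m) hrk hn hmn (hyperInd G) (hyperInd H) (hind G) (hind H)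
    (((G.card : ℝ) * H.card) / (n.choose k)) D (C0 * Real.exp 1 * √m) C0 hD (by positivity)
    (fun g hg => block_l1 hm1 l t ht hl g hg) (fun g hg D hD => block_sup l t ht hl g hg D hD)
  have hnum := final_numeric k s n hrk hn
  rw [← hm] at hnum
  set w : ℝ := Wpow k (s+1) (hyperInd G) ^ 2 * Wpow k (s+1) (hyperInd H) ^ 2 with hw
  have hw0 : 0 ≤ w := by positivity
  set Q : ℝ := ((n - 2 * (s+1)).choose (k - (s+1)) : ℝ) with hQ
  have hsm : 0 < √(m:ℝ) := Real.sqrt_pos.mpr (by exact_mod_cast hm1)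
  have hmm : (m:ℝ) ^ (s+1) = √m ^ s * √m ^ (s+2) := by
    rw [← pow_add, show s + (s+2) = 2 * (s+1) by ring, pow_mul, Real.sq_sqrt (Nat.cast_nonneg _)]
  have h1 : √m ^ (s+2) * (Q * w) ≤ E0 ^ k * D := by
    have h2 : √m ^ s * (√m ^ (s+2) * (Q * w)) ≤ √m ^ s * ((C0 * Real.exp 1) ^ s * C0 * D) := by
      calc _ = (m:ℝ) ^ (s+1) * (Q * w) := by rw [hmm]; ring
        _ ≤ _ := hmain
        _ = _ := by rw [mul_pow]; ring
    refine (le_of_mul_le_mul_left h2 (by positivity)).trans ?_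
    refine mul_le_mul_of_nonneg_right ?_ hD0
    calc (C0 * Real.exp 1) ^ s * C0 ≤ E0 ^ s * E0 := by
          refine mul_le_mul (pow_le_pow_left₀ (by positivity) ?_ _) ?_ hC00 (by positivity)
          · rw [hE0]; nlinarith
          · rw [hE0]; nlinarith
      _ = E0 ^ (s+1) := by rw [pow_succ]
      _ ≤ E0 ^ k := pow_le_pow_right₀ hE1 hrk
  have hE0k : 0 < E0 ^ k := by positivity
  calc _ = (√(1 / (4 * k)) ^ (k + 1) / (k.factorial : ℝ) * (n : ℝ) ^ (((k : ℝ) + 1) / 2)) * w / E0 ^ k := by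
        rw [hw]; ring
    _ ≤ (√m ^ (s+2) * Q) * w / E0 ^ k := by
        refine div_le_div_of_nonneg_right (mul_le_mul_of_nonneg_right hnum hw0) hE0k.le
    _ ≤ D := by
        rw [div_le_iff₀ hE0k]
        linarith
end

section
/- Let k, ℓ ∈ ℕ and let V be a finite set with |V| ≥ 2k ≥ 2ℓ. For any f : C(V,k) → ℝ, the following are equivalent: (i) W^k(f) = W^{k−1}(f) = ⋯ = W^ℓ(f) = 0; (ii) there exists a unique function h : C(V, ℓ−1) → ℝ such that for all R ∈ C(V,k), f(R) = Σ_{S ⊂ R, |S| = ℓ−1} h(S). -/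
open Finset

namespace Stmt7

/-- Unpacking injectivity of a sum-eliminator. -/
lemma sumElim_iff {A B C : Type*} (a : A → C) (b : B → C) :
    Function.Injective (Sum.elim a b) ↔
      Function.Injective a ∧ Function.Injective b ∧ ∀ i j, a i ≠ b j := by
  constructor
  · intro h
    refine ⟨fun i j e => ?_, fun i j e => ?_, fun i j e => ?_⟩
    · simpa using @h (Sum.inl i) (Sum.inl j) e
    · simpa using @h (Sum.inr i) (Sum.inr j) e
    · simpa using @h (Sum.inl i) (Sum.inr j) e
  · rintro ⟨h1, h2, h3⟩
    exact h1.sumElim h2 h3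

/-- 0/1 indicator of membership. -/
noncomputable def chi {V : Type*} [DecidableEq V] (x : V) (R : Finset V) : ℝ :=
  if x ∈ R then 1 else 0

/-- Upward sum. -/
noncomputable def H {V : Type*} [Fintype V] [DecidableEq V] (c : Finset V → ℝ) (S : Finset V) : ℝ :=
  ∑ R : Finset V, if S ⊆ R then c R else 0

lemma H_diff {V : Type*} [Fintype V] [DecidableEq V] (c : Finset V → ℝ) (x y : V) (T : Finset V) :
    H (fun R => c R * (chi x R - chi y R)) T = H c (insert x T) - H c (insert y T) := by
  unfold H chi
  rw [← Finset.sum_sub_distrib]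
  refine Finset.sum_congr rfl fun R _ => ?_
  simp only [Finset.insert_subset_iff]
  by_cases h1 : x ∈ R <;> by_cases h2 : y ∈ R <;> by_cases h3 : T ⊆ R <;> simp [h1, h2, h3]

lemma inj_cons {V : Type*} {r : ℕ} (a b : Fin r → V) (x y : V) (hxy : x ≠ y)
    (hab : Function.Injective (Sum.elim a b))
    (hax : ∀ i, a i ≠ x) (hay : ∀ i, a i ≠ y) (hbx : ∀ i, b i ≠ x) (hby : ∀ i, b i ≠ y) :
    Function.Injective (Sum.elim (Fin.cons x a : Fin (r+1) → V) (Fin.cons y b : Fin (r+1) → V)) := by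
  rw [sumElim_iff] at hab ⊢
  obtain ⟨h1, h2, h3⟩ := hab
  refine ⟨?_, ?_, ?_⟩
  · rw [Fin.cons_injective_iff]
    refine ⟨?_, h1⟩
    rintro ⟨i, hi⟩
    exact hax i hi
  · rw [Fin.cons_injective_iff]
    refine ⟨?_, h2⟩
    rintro ⟨i, hi⟩
    exact hby i hi
  · intro i j
    refine Fin.cases ?_ (fun i => ?_) i <;> refine Fin.cases ?_ (fun j => ?_) j
    · simpa using hxy
    · simpa using (hbx j).symm
    · simpa using hay i
    · simpa using h3 i j

lemma keyP {V : Type*} [Fintype V] [DecidableEq V] (r : ℕ) :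
    ∀ (W : Finset V) (c : Finset V → ℝ),
    (∀ T ⊆ W, T.card + 1 = r → ∑ z ∈ W \ T, H c (insert z T) = 0) →
    (∀ a b : Fin r → V, (∀ i, a i ∈ W) → (∀ i, b i ∈ W) →
      Function.Injective (Sum.elim a b) →
      ∑ R, c R * ∏ i, (chi (a i) R - chi (b i) R) = 0) →
    ∀ S ⊆ W, S.card = r → H c S = 0 := by
  induction r with
  | zero =>
    intro W c _ hS S _ hS0
    rw [Finset.card_eq_zero] at hS0
    subst hS0
    have := hS Fin.elim0 Fin.elim0 (fun i => i.elim0) (fun i => i.elim0)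
      (fun i => by rcases i with i | i <;> exact i.elim0)
    simpa [H] using this
  | succ r ih =>
    intro W c hD hS S hSW hSc
    have swap : ∀ x ∈ W, ∀ y ∈ W, x ≠ y → ∀ T ⊆ W \ {x, y}, T.card = r →
        H c (insert x T) = H c (insert y T) := by
      intro x hx y hy hxy T hT hTc
      have := ih (W \ {x, y}) (fun R => c R * (chi x R - chi y R)) ?_ ?_ T hT hTc
      · rw [H_diff] at this
        linarith
      · intro T' hT' hc
        have aux : ∀ x ∈ W, ∀ y ∈ W, x ≠ y → T' ⊆ W \ {x, y} →
            ∑ z ∈ (W \ {x, y}) \ T', H c (insert x (insert z T'))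
              = - H c (insert y (insert x T')) := by
          intro x hx y hy hxy hT'
          have hxT : x ∉ T' := fun h => by simpa using hT' h
          have hyT : y ∉ T' := fun h => by simpa using hT' h
          have h1 := hD (insert x T') (by
            rw [Finset.insert_subset_iff]
            exact ⟨hx, hT'.trans Finset.sdiff_subset⟩) (by
            rw [Finset.card_insert_of_notMem hxT, hc])
          have h2 : W \ insert x T' = insert y ((W \ {x, y}) \ T') := by
            ext z
            simp only [Finset.mem_sdiff, Finset.mem_insert, Finset.mem_singleton]
            by_cases hz : z = y
            · subst hz
              simp [hy, hyT, Ne.symm hxy]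
            · simp [hz]; tauto
          rw [h2, Finset.sum_insert (by simp)] at h1
          simp_rw [Finset.insert_comm x]
          linarith
        simp_rw [H_diff]
        rw [Finset.sum_sub_distrib, aux x hx y hy hxy hT',
          Finset.pair_comm, aux y hy x hx hxy.symm (by rwa [Finset.pair_comm]), Finset.insert_comm]
        ring
      · intro a b ha hb hab
        have hax : ∀ i, a i ≠ x := fun i h => by simpa [h] using ha i
        have hay : ∀ i, a i ≠ y := fun i h => by simpa [h] using ha i
        have hbx : ∀ i, b i ≠ x := fun i h => by simpa [h] using hb i
        have hby : ∀ i, b i ≠ y := fun i h => by simpa [h] using hb i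
        have := hS (Fin.cons x a) (Fin.cons y b)
          (fun i => by
            refine Fin.cases ?_ (fun i => ?_) i
            · simpa using hx
            · simpa using (Finset.mem_sdiff.1 (ha i)).1)
          (fun i => by
            refine Fin.cases ?_ (fun i => ?_) i
            · simpa using hy
            · simpa using (Finset.mem_sdiff.1 (hb i)).1)
          (inj_cons a b x y hxy hab hax hay hbx hby)
        simp only [Fin.prod_univ_succ, Fin.cons_zero, Fin.cons_succ] at this
        simpa only [mul_assoc] using this
    have hne : S.Nonempty := by
      rw [← Finset.card_pos]; omega
    obtain ⟨x, hx⟩ := hne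
    have hTc : (S.erase x).card = r := by rw [Finset.card_erase_of_mem hx]; omega
    have h1 := hD (S.erase x) ((Finset.erase_subset _ _).trans hSW) (by omega)
    have h2 : ∀ z ∈ W \ S.erase x, H c (insert z (S.erase x)) = H c S := by
      intro z hz
      have hz' := Finset.mem_sdiff.1 hz
      by_cases hzx : z = x
      · rw [hzx, Finset.insert_erase hx]
      · rw [swap z hz'.1 x (hSW hx) hzx (S.erase x) ?_ hTc, Finset.insert_erase hx]
        intro w hw
        have := Finset.mem_erase.1 hw
        simp only [Finset.mem_sdiff, Finset.mem_insert, Finset.mem_singleton]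
        refine ⟨hSW this.2, ?_⟩
        rintro (h | h)
        · subst h; exact hz'.2 hw
        · exact this.1 h
    rw [Finset.sum_congr rfl h2, Finset.sum_const, nsmul_eq_mul] at h1
    have h3 : (W \ S.erase x).card ≠ 0 := by
      rw [Finset.card_ne_zero]
      exact ⟨x, by simp [hSW hx]⟩
    rcases mul_eq_zero.1 h1 with h | h
    · exact absurd (by exact_mod_cast h) h3
    · exact h

lemma sum_H_insert {V : Type*} [Fintype V] [DecidableEq V] (k : ℕ) (c : Finset V → ℝ)
    (hc : ∀ R, R.card ≠ k → c R = 0) (T : Finset V) :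
    ∑ z ∈ Finset.univ \ T, H c (insert z T) = ((k : ℝ) - T.card) * H c T := by
  unfold H
  rw [Finset.sum_comm, Finset.mul_sum]
  refine Finset.sum_congr rfl fun R _ => ?_
  by_cases hT : T ⊆ R
  · simp only [Finset.insert_subset_iff, hT, and_true, if_true]
    rw [← Finset.sum_filter, Finset.sum_const, nsmul_eq_mul]
    have : (Finset.univ \ T).filter (fun z => z ∈ R) = R \ T := by
      ext z; simp; tauto
    rw [this, Finset.cast_card_sdiff hT]
    by_cases hR : R.card = k
    · rw [hR]
    · simp [hc R hR]
  · simp [Finset.insert_subset_iff, hT]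

/-- vanishing lemma -/
lemma vanish {V : Type*} [Fintype V] [DecidableEq V] (k m : ℕ) (c : Finset V → ℝ)
    (hc : ∀ R, R.card ≠ k → c R = 0)
    (h0 : ∀ T : Finset V, T.card = m → H c T = 0)
    (hS : ∀ r, m + 1 ≤ r → r ≤ k → ∀ a b : Fin r → V,
      Function.Injective (Sum.elim a b) →
      ∑ R, c R * ∏ i, (chi (a i) R - chi (b i) R) = 0) (hmk : m ≤ k) :
    c = 0 := by
  have key : ∀ r, m ≤ r → r ≤ k → ∀ T : Finset V, T.card = r → H c T = 0 := by
    intro r hr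
    induction r, hr using Nat.le_induction with
    | base => intro _; exact h0
    | succ r hr ih =>
      intro hrk T hT
      refine keyP (r+1) Finset.univ c ?_ (fun a b _ _ hab => hS (r+1) (by omega) hrk a b hab)
        T (Finset.subset_univ _) hT
      intro T' _ hT'
      rw [sum_H_insert k c hc, ih (by omega) T' (by omega), mul_zero]
  funext R
  by_cases hR : R.card = k
  · have := key k hmk le_rfl R hR
    unfold H at this
    rw [Finset.sum_eq_single R] at this
    · simpa using this
    · intro R' _ hne
      split_ifs with hsub
      · apply hc
        intro h
        exact hne (Finset.eq_of_subset_of_card_le hsub (by omega)).symm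
      · rfl
    · simp
  · exact hc R hR

lemma prod_cross {V : Type*} [DecidableEq V] {r : ℕ} (a b : Fin r → V)
    (hab : Function.Injective (Sum.elim a b)) (R : Finset V) :
    ∏ i, (chi (a i) R - chi (b i) R) =
      if ∀ i, (R ∩ {a i, b i}).card = 1 then
        (-1 : ℝ) ^ (R ∩ Finset.image b Finset.univ).card else 0 := by
  rw [sumElim_iff] at hab
  obtain ⟨h1, h2, h3⟩ := hab
  have hcard : ∀ i, (R ∩ {a i, b i}).card = 
      (if a i ∈ R then 1 else 0) + (if b i ∈ R then 1 else 0) := by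
    intro i
    by_cases ha : a i ∈ R <;> by_cases hb : b i ∈ R <;>
      simp [Finset.inter_insert_of_mem, Finset.inter_insert_of_notMem, ha, hb, h3 i i]
  split_ifs with hcr
  · have hterm : ∀ i, chi (a i) R - chi (b i) R = if b i ∈ R then (-1:ℝ) else 1 := by
      intro i
      have := hcr i
      rw [hcard] at this
      unfold chi
      by_cases ha : a i ∈ R <;> by_cases hb : b i ∈ R <;> simp_all
    simp_rw [hterm]
    rw [Finset.prod_ite]
    simp only [Finset.prod_const, one_pow, mul_one]
    congr 1
    have : R ∩ Finset.image b Finset.univ = (Finset.univ.filter (fun i => b i ∈ R)).image b := by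
      ext z; simp only [Finset.mem_inter, Finset.mem_image, Finset.mem_filter, Finset.mem_univ, true_and]
      constructor
      · rintro ⟨hz, i, rfl⟩; exact ⟨i, hz, rfl⟩
      · rintro ⟨i, hz, rfl⟩; exact ⟨hz, i, rfl⟩
    rw [this, Finset.card_image_of_injective _ h2]
  · push Not at hcr
    obtain ⟨i, hi⟩ := hcr
    refine Finset.prod_eq_zero (Finset.mem_univ i) ?_
    rw [hcard] at hi
    unfold chi
    by_cases ha : a i ∈ R <;> by_cases hb : b i ∈ R <;> simp_all

lemma Wpow_eq_zero {V : Type*} [Fintype V] [DecidableEq V] (k r : ℕ) (f : Finset V → ℝ) :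
    Wpow k r f = 0 ↔ ∀ a b : Fin r → V, Function.Injective (Sum.elim a b) →
      ∑ R : Finset V, (if R.card = k then f R else 0) * ∏ i, (chi (a i) R - chi (b i) R) = 0 := by
  have hsa : ∀ a b : Fin r → V, Function.Injective (Sum.elim a b) →
      (signedAvg k f a b = 0 ↔
      ∑ R : Finset V, (if R.card = k then f R else 0) * ∏ i, (chi (a i) R - chi (b i) R) = 0) := by
    intro a b hab
    have hsum : ∑ R : Finset V, (if R.card = k then f R else 0) * ∏ i, (chi (a i) R - chi (b i) R)
        = ∑ R ∈ (Finset.univ.powersetCard k).filter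
          (fun R => ∀ i, (R ∩ {a i, b i}).card = 1),
          (-1 : ℝ) ^ (R ∩ Finset.image b Finset.univ).card * f R := by
      have hu : (Finset.univ.powersetCard k).filter
          (fun R : Finset V => ∀ i, (R ∩ {a i, b i}).card = 1) =
          Finset.univ.filter (fun R : Finset V => R.card = k ∧ ∀ i, (R ∩ {a i, b i}).card = 1) := by
        ext R; simp [Finset.mem_powersetCard]
      rw [hu, Finset.sum_filter]
      refine Finset.sum_congr rfl fun R _ => ?_
      rw [prod_cross a b hab]
      by_cases h1 : R.card = k
      · by_cases h2 : ∀ i, (R ∩ {a i, b i}).card = 1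
        · rw [if_pos h1, if_pos h2, if_pos ⟨h1, h2⟩, mul_comm]
        · simp only [h2, and_false, if_false, mul_zero]
      · simp only [h1, false_and, if_false, zero_mul]
    rw [hsum]
    unfold signedAvg
    rw [div_eq_zero_iff]
    constructor
    · rintro (h | h)
      · exact h
      · rw [Nat.cast_eq_zero, Finset.card_eq_zero] at h
        rw [h, Finset.sum_empty]
    · exact Or.inl
  unfold Wpow
  rw [Real.sqrt_eq_zero (div_nonneg (Finset.sum_nonneg fun _ _ => sq_nonneg _) (Nat.cast_nonneg _)),
    div_eq_zero_iff]
  constructor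
  · rintro (h | h) a b hab
    · rw [Finset.sum_eq_zero_iff_of_nonneg (fun _ _ => sq_nonneg _)] at h
      have := h (a, b) (by simpa using hab)
      exact (hsa a b hab).1 (by simpa using this)
    · rw [Nat.cast_eq_zero, Finset.card_eq_zero] at h
      have : (a, b) ∈ (∅ : Finset ((Fin r → V) × (Fin r → V))) := by
        rw [← h]; simpa using hab
      simp at this
  · intro h
    left
    refine Finset.sum_eq_zero fun p hp => ?_
    have hp' : Function.Injective (Sum.elim p.1 p.2) := by simpa using hp
    rw [(hsa p.1 p.2 hp').2 (h p.1 p.2 hp')]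
    simp

lemma sum_S_zero {V : Type*} [Fintype V] [DecidableEq V] (k r : ℕ) (S : Finset V) (hS : S.card < r)
    (a b : Fin r → V) (hab : Function.Injective (Sum.elim a b)) :
    ∑ R : Finset V, (if R.card = k ∧ S ⊆ R then (1:ℝ) else 0) *
      ∏ i, (chi (a i) R - chi (b i) R) = 0 := by
  rw [sumElim_iff] at hab
  obtain ⟨h1, h2, h3⟩ := hab
  have hex : ∃ i, a i ∉ S ∧ b i ∉ S := by
    by_contra! hcon
    have : ∀ i, ∃ s ∈ S, s = a i ∨ s = b i := by
      intro i
      by_cases ha : a i ∈ S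
      · exact ⟨_, ha, Or.inl rfl⟩
      · exact ⟨_, hcon i ha, Or.inr rfl⟩
    choose g hg hg' using this
    have hinj : Function.Injective g := by
      intro i j hij
      rcases hg' i with hi | hi <;> rcases hg' j with hj | hj <;> rw [hi, hj] at hij
      · exact h1 hij
      · exact absurd hij (h3 i j)
      · exact absurd hij.symm (h3 j i)
      · exact h2 hij
    have := Finset.card_le_card_of_injOn (s := Finset.univ) (t := S) g (fun i _ => hg i) hinj.injOn
    simp at this
    omega
  obtain ⟨i, hai, hbi⟩ := hex
  set σ : Equiv.Perm V := Equiv.swap (a i) (b i) with hσ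
  have hmem : ∀ z (R : Finset V), z ∈ σ.finsetCongr R ↔ σ z ∈ R := by
    intro z R
    simp [Equiv.finsetCongr_apply, Finset.mem_map_equiv, hσ]
  have hfix : ∀ z, z ≠ a i → z ≠ b i → σ z = z := fun z h h' => Equiv.swap_apply_of_ne_of_ne h h'
  have hneg : ∀ R : Finset V, (if (σ.finsetCongr R).card = k ∧ S ⊆ σ.finsetCongr R then (1:ℝ) else 0) *
      ∏ j, (chi (a j) (σ.finsetCongr R) - chi (b j) (σ.finsetCongr R)) =
      - ((if R.card = k ∧ S ⊆ R then (1:ℝ) else 0) *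
      ∏ j, (chi (a j) R - chi (b j) R)) := by
    intro R
    have hcard : (σ.finsetCongr R).card = R.card := by simp [Equiv.finsetCongr_apply]
    have hsub : S ⊆ σ.finsetCongr R ↔ S ⊆ R := by
      have : ∀ z ∈ S, (z ∈ σ.finsetCongr R ↔ z ∈ R) := by
        intro z hz
        rw [hmem, hfix z (fun h => hai (h ▸ hz)) (fun h => hbi (h ▸ hz))]
      exact forall₂_congr this
    simp only [hcard, hsub]
    rw [← mul_neg]
    congr 1
    rw [← Finset.mul_prod_erase _ _ (Finset.mem_univ i), ← Finset.mul_prod_erase _ (fun j => chi (a j) R - chi (b j) R) (Finset.mem_univ i)]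
    rw [← neg_mul]
    congr 1
    · simp only [chi, hmem]
      simp only [hσ, Equiv.swap_apply_left, Equiv.swap_apply_right]
      ring
    · refine Finset.prod_congr rfl fun j hj => ?_
      have hji := (Finset.mem_erase.1 hj).1
      simp only [chi, hmem]
      rw [hfix (a j) (fun h => hji (h1 h)) (h3 j i), hfix (b j) (fun h => h3 i j h.symm) (fun h => hji (h2 h))]
  have := Equiv.sum_comp σ.finsetCongr (fun R => (if R.card = k ∧ S ⊆ R then (1:ℝ) else 0) *
      ∏ j, (chi (a j) R - chi (b j) R))
  simp only [hneg, Finset.sum_neg_distrib] at this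
  linarith

/-- functions of the form sum over subsets have zero Specht sums -/
lemma specht_zero {V : Type*} [Fintype V] [DecidableEq V] (k m r : ℕ) (hmr : m < r)
    (f h : Finset V → ℝ)
    (hf : ∀ R : Finset V, R.card = k → f R = ∑ S ∈ R.powersetCard m, h S)
    (a b : Fin r → V) (hab : Function.Injective (Sum.elim a b)) :
    ∑ R : Finset V, (if R.card = k then f R else 0) * ∏ i, (chi (a i) R - chi (b i) R) = 0 := by
  have h1 : ∀ R : Finset V, (if R.card = k then f R else 0) * ∏ i, (chi (a i) R - chi (b i) R) =
      ∑ S ∈ Finset.univ.powersetCard m, h S * ((if R.card = k ∧ S ⊆ R then (1:ℝ) else 0) *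
      ∏ i, (chi (a i) R - chi (b i) R)) := by
    intro R
    simp_rw [← mul_assoc]
    rw [← Finset.sum_mul]
    congr 1
    split_ifs with hR
    · simp only [hR, true_and, mul_ite, mul_one, mul_zero]
      rw [hf R hR, ← Finset.sum_filter]
      refine Finset.sum_congr ?_ fun _ _ => rfl
      ext S; simp [Finset.mem_powersetCard, and_comm]
    · simp [hR]
  simp_rw [h1]
  rw [Finset.sum_comm]
  refine Finset.sum_eq_zero fun S hS => ?_
  rw [← Finset.mul_sum, sum_S_zero k r S (by rw [(Finset.mem_powersetCard.1 hS).2]; exact hmr) a b hab,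
    mul_zero]

/-- swap-invariant functions are constant on m-sets. -/
lemma const_of_swap {V : Type*} [DecidableEq V] (W : Finset V) (m : ℕ) (h : Finset V → ℝ)
    (hsw : ∀ x ∈ W, ∀ y ∈ W, x ≠ y → ∀ T ⊆ W \ {x, y}, T.card + 1 = m →
      h (insert x T) = h (insert y T)) :
    ∀ d, ∀ S ⊆ W, ∀ S' ⊆ W, S.card = m → S'.card = m → (S \ S').card = d → h S = h S' := by
  intro d
  induction d with
  | zero =>
    intro S _ S' _ hc hc' hd
    rw [Finset.card_eq_zero, Finset.sdiff_eq_empty_iff_subset] at hd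
    rw [Finset.eq_of_subset_of_card_le hd (by omega)]
  | succ d ih =>
    intro S hS S' hS' hc hc' hd
    have hd' : (S' \ S).card = d + 1 := by
      rw [← hd]; exact (Finset.card_sdiff_comm (by omega)).symm
    obtain ⟨x, hx⟩ := Finset.card_pos.1 (by omega : 0 < (S \ S').card)
    obtain ⟨y, hy⟩ := Finset.card_pos.1 (by omega : 0 < (S' \ S).card)
    rw [Finset.mem_sdiff] at hx hy
    have hxy : x ≠ y := fun e => hy.2 (e ▸ hx.1)
    have e1 : h S = h (insert y (S.erase x)) := by
      conv_lhs => rw [← Finset.insert_erase hx.1]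
      refine hsw x (hS hx.1) y (hS' hy.1) hxy _ ?_ (by rw [Finset.card_erase_add_one hx.1, hc])
      intro z hz
      rw [Finset.mem_erase] at hz
      simp only [Finset.mem_sdiff, Finset.mem_insert, Finset.mem_singleton]
      refine ⟨hS hz.2, ?_⟩
      rintro (e | e)
      · exact hz.1 e
      · exact hy.2 (e ▸ hz.2)
    have hyn : y ∉ S.erase x := fun hh => hy.2 (Finset.mem_of_mem_erase hh)
    rw [e1]
    refine ih _ ?_ S' hS' ?_ hc' ?_
    · rw [Finset.insert_subset_iff]
      exact ⟨hS' hy.1, (Finset.erase_subset _ _).trans hS⟩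
    · rw [Finset.card_insert_of_notMem hyn, Finset.card_erase_add_one hx.1, hc]
    · have : insert y (S.erase x) \ S' = (S \ S').erase x := by
        ext z
        simp only [Finset.mem_sdiff, Finset.mem_insert, Finset.mem_erase]
        constructor
        · rintro ⟨rfl | h1, h2⟩
          · exact absurd hy.1 h2
          · exact ⟨h1.1, h1.2, h2⟩
        · rintro ⟨h1, h2, h3⟩
          exact ⟨Or.inr ⟨h1, h2⟩, h3⟩
      rw [this, Finset.card_erase_of_mem (Finset.mem_sdiff.2 hx), hd]
      rfl

/-- injectivity of the inclusion matrix -/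
lemma incl_inj {V : Type*} [DecidableEq V] (m : ℕ) : ∀ (k : ℕ) (W : Finset V) (h : Finset V → ℝ),
    m ≤ k → m + k ≤ W.card →
    (∀ R ⊆ W, R.card = k → ∑ S ∈ R.powersetCard m, h S = 0) →
    ∀ S ⊆ W, S.card = m → h S = 0 := by
  induction m with
  | zero =>
    intro k W h _ hW hh S _ hS0
    rw [Finset.card_eq_zero] at hS0
    subst hS0
    obtain ⟨R, hR, hRc⟩ := Finset.exists_subset_card_eq (by omega : k ≤ W.card)
    simpa using hh R hR hRc
  | succ m ih =>
    intro k W h hmk hW hh S hS hSc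
    obtain ⟨k, rfl⟩ : ∃ k', k = k' + 1 := ⟨k - 1, by omega⟩
    have hsw : ∀ x ∈ W, ∀ y ∈ W, x ≠ y → ∀ T ⊆ W \ {x, y}, T.card + 1 = m + 1 →
      h (insert x T) = h (insert y T) := by
      intro x hx y hy hxy T hT hTc
      have hcW : (W \ {x, y}).card + 2 = W.card := by
        rw [← Finset.card_pair hxy]
        exact Finset.card_sdiff_add_card_eq_card (by
          intro z; simp only [Finset.mem_insert, Finset.mem_singleton]
          rintro (rfl | rfl) <;> assumption)
      have := ih k (W \ {x, y}) (fun T => h (insert x T) - h (insert y T)) (by omega) (by omega) ?_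
        T hT (by omega)
      · exact sub_eq_zero.1 this
      · intro R hR hRc
        have aux : ∀ x ∈ W, x ∉ R → ∑ S ∈ R.powersetCard m, h (insert x S) =
            - ∑ S ∈ R.powersetCard (m+1), h S := by
          intro x hx hxR
          have := hh (insert x R) (by
            rw [Finset.insert_subset_iff]; exact ⟨hx, hR.trans Finset.sdiff_subset⟩)
            (by rw [Finset.card_insert_of_notMem hxR, hRc])
          rw [Finset.powersetCard_succ_insert hxR, Finset.sum_union, Finset.sum_image] at this
          · linarith
          · intro A hA B hB hAB
            have hA' : x ∉ A := fun hh => hxR ((Finset.mem_powersetCard.1 hA).1 hh)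
            have hB' : x ∉ B := fun hh => hxR ((Finset.mem_powersetCard.1 hB).1 hh)
            rw [← Finset.erase_insert hA', ← Finset.erase_insert hB']
            exact congrArg (fun s => Finset.erase s x) hAB
          · rw [Finset.disjoint_left]
            intro A hA hA2
            obtain ⟨B, _, rfl⟩ := Finset.mem_image.1 hA2
            exact hxR ((Finset.mem_powersetCard.1 hA).1 (Finset.mem_insert_self _ _))
        have hxR : x ∉ R := fun hh => by simpa using hR hh
        have hyR : y ∉ R := fun hh => by simpa using hR hh
        rw [Finset.sum_sub_distrib, aux x hx hxR, aux y hy hyR, sub_self]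
    have hconst := const_of_swap W (m+1) h hsw
    obtain ⟨R, hSR, hR, hRc⟩ := Finset.exists_subsuperset_card_eq hS (by omega : S.card ≤ k + 1) (by omega)
    have h1 := hh R hR hRc
    rw [Finset.sum_congr rfl (fun S' hS' => hconst _ S' ((Finset.mem_powersetCard.1 hS').1.trans hR) S hS
      (Finset.mem_powersetCard.1 hS').2 hSc rfl), Finset.sum_const, nsmul_eq_mul,
      Finset.card_powersetCard, hRc] at h1
    rcases mul_eq_zero.1 h1 with h2 | h2
    · have := Nat.choose_pos (by omega : m + 1 ≤ k + 1)
      rw [Nat.cast_eq_zero] at h2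
      omega
    · exact h2

/-- orthogonal decomposition -/
lemma decomp {V : Type*} [Fintype V] [DecidableEq V] (k m : ℕ) (f : Finset V → ℝ) :
    ∃ h : Finset V → ℝ, ∀ T : Finset V, T.card = m →
      H (fun R => if R.card = k then f R - ∑ S ∈ R.powersetCard m, h S else 0) T = 0 := by
  classical
  let e : Finset V → EuclideanSpace ℝ (Finset V) := fun T =>
    WithLp.toLp 2 (fun R => if R.card = k ∧ T.card = m ∧ T ⊆ R then (1:ℝ) else 0)
  let F : EuclideanSpace ℝ (Finset V) := WithLp.toLp 2 f
  let K : Submodule ℝ (EuclideanSpace ℝ (Finset V)) := Submodule.span ℝ (Set.range e)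
  obtain ⟨u, hu, v, hv, huv⟩ := K.exists_add_mem_mem_orthogonal F
  obtain ⟨h, hh⟩ := (Submodule.mem_span_range_iff_exists_fun ℝ).1 hu
  refine ⟨h, fun T hT => ?_⟩
  have hin : inner ℝ (e T) v = 0 := (Submodule.mem_orthogonal K v).1 hv _
    (Submodule.subset_span ⟨T, rfl⟩)
  have hv' : v = F - u := by rw [huv]; abel
  rw [PiLp.inner_apply] at hin
  refine Eq.trans ?_ hin
  unfold H
  refine Finset.sum_congr rfl fun R _ => ?_
  have hvR : v R = f R - ∑ S, h S * (if R.card = k ∧ S.card = m ∧ S ⊆ R then (1:ℝ) else 0) := by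
    rw [hv', ← hh]
    simp [F, e]
  rw [hvR]
  by_cases hR : R.card = k
  · by_cases hTR : T ⊆ R
    · simp only [hR, hTR, hT, if_true, true_and, e, mul_ite, mul_one, mul_zero, and_self]
      have : R.powersetCard m = Finset.univ.filter (fun S => S.card = m ∧ S ⊆ R) := by
        ext S; simp [Finset.mem_powersetCard, and_comm]
      rw [this, Finset.sum_filter]
      simp
    · simp [e, hTR]
  · simp [e, hR]

end Stmt7

open Stmt7 in
theorem stmt7 {V : Type*} [Fintype V] [DecidableEq V] (k ℓ : ℕ)
    (hℓ : 1 ≤ ℓ) (hlk : 2 * ℓ ≤ 2 * k) (hkV : 2 * k ≤ Fintype.card V)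
    (f : Finset V → ℝ) :
    (∀ r : ℕ, ℓ ≤ r → r ≤ k → Wpow k r f = 0) ↔
    (∃! h : Finset V → ℝ,
      (∀ S : Finset V, S.card ≠ ℓ - 1 → h S = 0) ∧
      ∀ R ∈ (Finset.univ : Finset V).powersetCard k,
        f R = ∑ S ∈ R.powersetCard (ℓ - 1), h S) := by
  constructor
  · intro hW
    obtain ⟨h, hh⟩ := decomp k (ℓ - 1) f
    have hc := vanish k (ℓ - 1)
      (fun R => if R.card = k then f R - ∑ S ∈ R.powersetCard (ℓ - 1), h S else 0)
      (fun R hR => if_neg hR) hh (by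
        intro r hr hrk a b hab
        have h1 := (Wpow_eq_zero k r f).1 (hW r (by omega) hrk) a b hab
        have h2 := specht_zero k (ℓ - 1) r (by omega)
          (fun R => ∑ S ∈ R.powersetCard (ℓ - 1), h S) h (fun _ _ => rfl) a b hab
        have h3 := congrArg₂ (· - ·) h1 h2
        simp only [← Finset.sum_sub_distrib, sub_zero] at h3
        refine Eq.trans ?_ h3
        refine Finset.sum_congr rfl fun R _ => ?_
        split_ifs <;> ring) (by omega)
    have hf : ∀ R : Finset V, R.card = k → f R = ∑ S ∈ R.powersetCard (ℓ - 1), h S := by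
      intro R hR
      have := congrFun hc R
      simp only [hR, if_true, Pi.zero_apply] at this
      linarith
    refine ⟨fun S => if S.card = ℓ - 1 then h S else 0, ⟨fun S hS => if_neg hS, ?_⟩, ?_⟩
    · intro R hR
      rw [hf R (Finset.mem_powersetCard.1 hR).2]
      refine Finset.sum_congr rfl fun S hS => ?_
      simp only [if_pos (Finset.mem_powersetCard.1 hS).2]
    · rintro g ⟨hg0, hg⟩
      funext S
      by_cases hS : S.card = ℓ - 1
      · simp only [hS, if_true]
        have := incl_inj (ℓ - 1) k Finset.univ (fun S => g S - h S) (by omega)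
          (by rw [Finset.card_univ]; omega) (by
            intro R _ hR
            rw [Finset.sum_sub_distrib, ← hf R hR, ← hg R (by simp [Finset.mem_powersetCard, hR]),
              sub_self]) S (Finset.subset_univ _) hS
        exact sub_eq_zero.1 this
      · simp [hS, hg0 S hS]
  · rintro ⟨h, ⟨_, hf⟩, _⟩ r hr _
    rw [Wpow_eq_zero]
    intro a b hab
    exact specht_zero k (ℓ - 1) r (by omega) f h
      (fun R hR => hf R (by simp [Finset.mem_powersetCard, hR])) a b hab
end

section
/- Let n, k, r ∈ ℕ with n ≥ 2k ≥ 2r. Let P ∈ ℝ[x₁,…,x_n] be a harmonic multilinear polynomial, and let P^{=r} denote its homogeneous degree-r component. Then E_{σ ~ Slice(n,k)} [ (P^{=r}(σ))² ] ≤ 4^r · C(k,r) · (W^r(P))², where the expectation is over a uniformly random 0-1 vector σ with exactly k ones, and W^r(P) is the level-r weight of the restriction of P to Slice(n,k) (identified with C([n],k)). -/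
open Finset

section slice
variable {V : Type*} [Fintype V] [DecidableEq V]

/-- coefficient-level harmonicity -/
def Harm (c : Finset V → ℝ) : Prop := ∀ S : Finset V, ∑ i ∈ Sᶜ, c (insert i S) = 0

lemma Harm.G {c : Finset V → ℝ} (hc : Harm c) (t : ℕ) (W : Finset V) (hW : W.card < t) :
    ∑ T ∈ (powersetCard t univ).filter (fun T => W ⊆ T), c T = 0 := by
  have h1 : ∑ T ∈ (powersetCard t univ).filter (fun T => W ⊆ T), ∑ i ∈ T \ W, c T
      = ∑ S ∈ (powersetCard (t-1) univ).filter (fun T => W ⊆ T), ∑ i ∈ Sᶜ, c (insert i S) := by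
    rw [Finset.sum_sigma', Finset.sum_sigma']
    refine Finset.sum_bij' (fun x _ => ⟨x.1.erase x.2, x.2⟩) (fun x _ => ⟨insert x.2 x.1, x.2⟩)
      ?_ ?_ ?_ ?_ ?_
    · rintro ⟨T, i⟩ h
      simp only [mem_sigma, mem_filter, mem_powersetCard, subset_univ, true_and, mem_sdiff,
        mem_compl] at h ⊢
      obtain ⟨⟨h1, h2⟩, h3, h4⟩ := h
      refine ⟨⟨?_, ?_⟩, ?_⟩
      · rw [card_erase_of_mem h3, h1]
      · intro x hx
        rw [mem_erase]
        exact ⟨fun h => h4 (h ▸ hx), h2 hx⟩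
      · simp
    · rintro ⟨T, i⟩ h
      simp only [mem_sigma, mem_filter, mem_powersetCard, subset_univ, true_and, mem_sdiff,
        mem_compl] at h ⊢
      obtain ⟨⟨h1, h2⟩, h3⟩ := h
      refine ⟨⟨?_, ?_⟩, ?_, ?_⟩
      · rw [card_insert_of_notMem h3, h1]; omega
      · exact h2.trans (subset_insert _ _)
      · simp
      · exact fun h => h3 (h2 h)
    · rintro ⟨T, i⟩ h
      simp only [mem_sigma, mem_filter, mem_powersetCard, subset_univ, true_and, mem_sdiff,
        mem_compl] at h
      simp [insert_erase h.2.1]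
    · rintro ⟨T, i⟩ h
      simp only [mem_sigma, mem_filter, mem_powersetCard, subset_univ, true_and, mem_sdiff,
        mem_compl] at h
      simp [erase_insert h.2]
    · rintro ⟨T, i⟩ h
      simp only [mem_sigma, mem_filter, mem_powersetCard, subset_univ, true_and, mem_sdiff,
        mem_compl] at h
      simp [insert_erase h.2.1]
  have h2 : ∑ T ∈ (powersetCard t univ).filter (fun T => W ⊆ T), ∑ i ∈ T \ W, c T
      = ((t : ℝ) - W.card) * ∑ T ∈ (powersetCard t univ).filter (fun T => W ⊆ T), c T := by
    rw [mul_sum]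
    refine sum_congr rfl fun T hT => ?_
    simp only [mem_filter, mem_powersetCard, subset_univ, true_and] at hT
    rw [sum_const, card_sdiff_of_subset hT.2, nsmul_eq_mul, Nat.cast_sub (card_le_card hT.2), hT.1]
  rw [h2, sum_congr rfl (fun S _ => hc S), sum_const_zero] at h1
  rcases mul_eq_zero.1 h1 with h | h
  · exfalso
    have : (W.card : ℝ) < t := by exact_mod_cast hW
    linarith
  · exact h

lemma G_self (c : Finset V → ℝ) (A : Finset V) :
    ∑ T ∈ (powersetCard A.card univ).filter (fun T => A ⊆ T), c T = c A := by
  rw [show (powersetCard A.card univ).filter (fun T => A ⊆ T) = {A} from ?_, sum_singleton]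
  ext T
  simp only [mem_filter, mem_powersetCard, subset_univ, true_and, mem_singleton]
  constructor
  · rintro ⟨h1, h2⟩
    exact (eq_of_subset_of_card_le h2 h1.le).symm
  · rintro rfl; simp

/-- exact intersection sums -/
lemma Harm.F {c : Finset V → ℝ} (hc : Harm c) (A U : Finset V) (hU : U ⊆ A) :
    ∑ T ∈ (powersetCard A.card univ).filter (fun T => T ∩ A = U), c T
      = (-1) ^ (A \ U).card * c A := by
  have key : ∀ T : Finset V, (if T ∩ A = U then c T else 0)
      = ∑ W ∈ (A \ U).powerset, (-1 : ℝ) ^ W.card * (if U ∪ W ⊆ T then c T else 0) := by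
    intro T
    by_cases hUT : U ⊆ T
    · have e1 : ∑ W ∈ (A \ U).powerset, (-1 : ℝ) ^ W.card * (if U ∪ W ⊆ T then c T else 0)
          = ∑ W ∈ ((A \ U) ∩ T).powerset, (-1 : ℝ) ^ W.card * c T := by
        have : ((A \ U) ∩ T).powerset = (A \ U).powerset.filter (fun W => U ∪ W ⊆ T) := by
          ext W
          simp only [mem_powerset, mem_filter, subset_inter_iff, union_subset_iff]
          tauto
        rw [this, sum_filter]
        refine sum_congr rfl fun W _ => ?_
        split_ifs <;> simp
      rw [e1, ← sum_mul]
      have h3 := Finset.sum_powerset_neg_one_pow_card (x := (A \ U) ∩ T)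
      have h4 : ∑ W ∈ ((A \ U) ∩ T).powerset, (-1 : ℝ) ^ W.card
          = if (A \ U) ∩ T = ∅ then 1 else 0 := by
        have := congrArg (fun z : ℤ => (z : ℝ)) h3
        push_cast at this
        exact this
      rw [h4]
      have h5 : T ∩ A = U ↔ (A \ U) ∩ T = ∅ := by
        constructor
        · rintro rfl
          ext x; simp
        · intro h
          ext x
          have := Finset.ext_iff.1 h x
          have h6 := @hUT x
          have h7 := @hU x
          simp at this ⊢
          tauto
      by_cases h : T ∩ A = U
      · rw [if_pos h, if_pos (h5.1 h), one_mul]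
      · rw [if_neg h, if_neg (fun h' => h (h5.2 h')), zero_mul]
    · have hne : ¬ (T ∩ A = U) := fun h => hUT (by rw [← h]; exact inter_subset_left)
      rw [if_neg hne, sum_eq_zero]
      intro W _
      rw [if_neg (fun h => hUT (union_subset_left h)), mul_zero]
  rw [sum_filter, sum_congr rfl (fun T _ => key T), sum_comm]
  rw [sum_eq_single (A \ U)]
  · rw [← mul_sum, ← sum_filter, union_sdiff_of_subset hU, G_self]
  · intro W hW hne
    rw [← mul_sum, ← sum_filter, hc.G, mul_zero]
    rw [mem_powerset] at hW
    apply card_lt_card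
    rw [Finset.ssubset_iff_subset_ne]
    refine ⟨union_subset hU (hW.trans sdiff_subset), ?_⟩
    rintro rfl
    apply hne
    apply subset_antisymm hW
    intro x hx
    simp at hx
    tauto
  · simp

lemma count_sup (k : ℕ) (hk : k ≤ Fintype.card V) (B : Finset V) :
    ((powersetCard k univ).filter (fun R => B ⊆ R)).card
      = (Fintype.card V - B.card).choose (Fintype.card V - k) := by
  rw [← card_compl, ← card_powersetCard]
  refine card_bij' (fun R _ => Rᶜ) (fun R _ => Rᶜ) ?_ ?_ ?_ ?_
  · intro R hR
    simp only [mem_filter, mem_powersetCard, subset_univ, true_and] at hR ⊢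
    exact ⟨compl_subset_compl.2 hR.2, by rw [card_compl, hR.1]⟩
  · intro R hR
    simp only [mem_filter, mem_powersetCard, subset_univ, true_and] at hR ⊢
    refine ⟨by rw [card_compl, hR.2]; omega, ?_⟩
    rw [← compl_subset_compl, compl_compl]; exact hR.1
  · simp
  · simp

lemma count2 (k : ℕ) (A B : Finset V) (hAB : Disjoint A B) (hAk : A.card ≤ k) :
    ((powersetCard k univ).filter (fun R => A ⊆ R ∧ Disjoint R B)).card
      = (Fintype.card V - (A.card + B.card)).choose (k - A.card) := by
  rw [← card_union_of_disjoint hAB, ← card_compl, ← card_powersetCard]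
  refine card_bij' (fun R _ => R \ A) (fun R _ => R ∪ A) ?_ ?_ ?_ ?_
  · intro R hR
    simp only [mem_filter, mem_powersetCard, subset_univ, true_and] at hR ⊢
    refine ⟨?_, by rw [card_sdiff_of_subset hR.2.1, hR.1]⟩
    intro x hx
    have hd : x ∈ R → x ∉ B := fun hx => Finset.disjoint_left.1 hR.2.2 hx
    simp at hx ⊢
    tauto
  · intro R hR
    simp only [mem_filter, mem_powersetCard, subset_univ, true_and] at hR ⊢
    have h1 : Disjoint R A := by
      rw [Finset.disjoint_left]; intro x hx
      have := hR.1 hx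
      simp at this; tauto
    refine ⟨by rw [card_union_of_disjoint h1, hR.2]; omega, subset_union_right, ?_⟩
    rw [disjoint_union_left]
    refine ⟨?_, hAB⟩
    rw [Finset.disjoint_left]; intro x hx
    have := hR.1 hx
    simp at this; tauto
  · intro R hR
    simp only [mem_filter, mem_powersetCard, subset_univ, true_and] at hR
    exact sdiff_union_of_subset hR.2.1
  · intro R hR
    simp only [mem_powersetCard] at hR
    ext x
    have := @hR.1 x
    simp at this ⊢
    tauto

/-- core identity -/
lemma Harm.core {c : Finset V → ℝ} (hc : Harm c) (k r t : ℕ) (hrk : r ≤ k)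
    (hn : 2 * k ≤ Fintype.card V) (htk : t ≤ k) (hrt : r ≤ t) (A : Finset V) (hA : A.card = r) :
    ∑ R ∈ powersetCard k (univ : Finset V), (if A ⊆ R then (1:ℝ) else 0) *
      ∑ T ∈ powersetCard t univ, (if T ⊆ R then c T else 0)
    = if t = r then ((Fintype.card V - 2 * r).choose (k - r) : ℝ) * c A else 0 := by
  set n := Fintype.card V with hndef
  have e1 : ∑ R ∈ powersetCard k (univ : Finset V), (if A ⊆ R then (1:ℝ) else 0) *
      ∑ T ∈ powersetCard t univ, (if T ⊆ R then c T else 0)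
      = ∑ T ∈ powersetCard t univ, c T * ((n - (A ∪ T).card).choose (n - k) : ℝ) := by
    simp_rw [mul_sum]
    rw [sum_comm]
    refine sum_congr rfl fun T _ => ?_
    rw [← count_sup k (by omega), card_filter]
    push_cast
    rw [mul_sum]
    refine sum_congr rfl fun R _ => ?_
    by_cases h1 : A ⊆ R <;> by_cases h2 : T ⊆ R <;> simp [h1, h2, union_subset_iff]
  have e2 : ∀ T ∈ powersetCard t (univ : Finset V),
      c T * ((n - (A ∪ T).card).choose (n - k) : ℝ)
      = ∑ W ∈ A.powerset, ((n - t - r).choose (n - k - W.card) : ℝ) * if W ⊆ T then c T else 0 := by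
    intro T hT
    simp only [mem_powersetCard, subset_univ, true_and] at hT
    have f1 : ∑ W ∈ A.powerset, ((n - t - r).choose (n - k - W.card) : ℝ) *
        (if W ⊆ T then c T else 0)
        = ∑ W ∈ (A ∩ T).powerset, ((n - t - r).choose (n - k - W.card) : ℝ) * c T := by
      have : (A ∩ T).powerset = A.powerset.filter (fun W => W ⊆ T) := by
        ext W
        simp only [mem_powerset, mem_filter, subset_inter_iff]
      rw [this, sum_filter]
      refine sum_congr rfl fun W _ => ?_
      split_ifs <;> simp
    have hm : (A ∩ T).card ≤ r := hA ▸ card_le_card inter_subset_left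
    have hu := card_union_add_card_inter A T
    have f2 : n - (A ∪ T).card = (A ∩ T).card + (n - t - r) := by omega
    rw [f1, ← sum_mul, mul_comm]
    congr 1
    rw [f2, Nat.add_choose_eq, Finset.Nat.sum_antidiagonal_eq_sum_range_succ
      (fun i j => (A ∩ T).card.choose i * (n - t - r).choose j)]
    rw [Finset.sum_powerset_apply_card (fun m => ((n - t - r).choose (n - k - m) : ℝ))]
    push_cast
    simp_rw [nsmul_eq_mul]
    symm
    apply sum_subset
    · intro x; simp; omega
    · intro x _ hx
      rw [Nat.choose_eq_zero_of_lt (by simpa using hx)]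
      simp
  rw [e1, sum_congr rfl e2, sum_comm]
  simp_rw [← mul_sum, ← sum_filter]
  split_ifs with h
  · subst h
    rw [sum_eq_single A]
    · rw [← hA, G_self, hA]
      congr 2
      rw [← Nat.choose_symm (by omega)]
      congr 1 <;> omega
    · intro W hW hne
      rw [hc.G, mul_zero]
      rw [mem_powerset] at hW
      rw [← hA]
      exact card_lt_card (Finset.ssubset_iff_subset_ne.2 ⟨hW, hne⟩)
    · simp
  · apply sum_eq_zero
    intro W hW
    rw [hc.G, mul_zero]
    rw [mem_powerset] at hW
    have := card_le_card hW
    omega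

end slice

section slice2
variable {V : Type*} [Fintype V] [DecidableEq V]

def Xs {r : ℕ} (a b : Fin r → V) (I : Finset (Fin r)) : Finset V :=
  univ.image (fun i => if i ∈ I then b i else a i)

noncomputable def ww {r : ℕ} (a b : Fin r → V) (R : Finset V) : ℝ :=
  ∏ i, ((if a i ∈ R then (1:ℝ) else 0) - (if b i ∈ R then 1 else 0))

noncomputable def DD {r : ℕ} (c : Finset V → ℝ) (a b : Fin r → V) : ℝ :=
  ∑ I : Finset (Fin r), (-1 : ℝ) ^ I.card * c (Xs a b I)

lemma inj_facts {r : ℕ} {a b : Fin r → V} (h : Function.Injective (Sum.elim a b)) :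
    Function.Injective a ∧ Function.Injective b ∧ ∀ i j, a i ≠ b j := by
  refine ⟨fun i j hij => ?_, fun i j hij => ?_, fun i j hij => ?_⟩
  · have := @h (Sum.inl i) (Sum.inl j) hij
    simpa using this
  · have := @h (Sum.inr i) (Sum.inr j) hij
    simpa using this
  · have := @h (Sum.inl i) (Sum.inr j) hij
    simp at this

lemma Xs_subset {r : ℕ} (a b : Fin r → V) (I : Finset (Fin r)) (R : Finset V) :
    Xs a b I ⊆ R ↔ (∀ i, i ∉ I → a i ∈ R) ∧ (∀ i ∈ I, b i ∈ R) := by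
  unfold Xs
  rw [image_subset_iff]
  constructor
  · intro h
    refine ⟨fun i hi => ?_, fun i hi => ?_⟩
    · simpa [hi] using h i (mem_univ _)
    · simpa [hi] using h i (mem_univ _)
  · rintro ⟨h1, h2⟩ i _
    split_ifs with h
    exacts [h2 i h, h1 i h]

lemma Xs_inj {r : ℕ} {a b : Fin r → V} (h : Function.Injective (Sum.elim a b))
    (I : Finset (Fin r)) : Function.Injective (fun i => if i ∈ I then b i else a i) := by
  obtain ⟨h1, h2, h3⟩ := inj_facts h
  intro i j hij
  simp only at hij
  split_ifs at hij
  · exact h2 hij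
  · exact absurd hij.symm (h3 _ _)
  · exact absurd hij (h3 _ _)
  · exact h1 hij

lemma Xs_card {r : ℕ} {a b : Fin r → V} (h : Function.Injective (Sum.elim a b))
    (I : Finset (Fin r)) : (Xs a b I).card = r := by
  unfold Xs
  rw [card_image_of_injective _ (Xs_inj h I)]
  simp

lemma ww_expand {r : ℕ} (a b : Fin r → V) (R : Finset V) :
    ww a b R = ∑ I : Finset (Fin r), (-1 : ℝ) ^ I.card * (if Xs a b I ⊆ R then 1 else 0) := by
  unfold ww
  rw [Finset.prod_sub, powerset_univ]
  refine sum_congr rfl fun I _ => ?_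
  rw [mul_assoc, prod_boole, prod_boole]
  congr 1
  simp only [Xs_subset, mem_sdiff, mem_univ, true_and]
  split_ifs <;> simp_all

lemma inter_pair_card (R : Finset V) (x y : V) (hxy : x ≠ y) :
    (R ∩ {x, y}).card = 1 ↔ ¬ (x ∈ R ↔ y ∈ R) := by
  by_cases hx : x ∈ R <;> by_cases hy : y ∈ R <;>
    simp [hx, hy, inter_insert_of_mem, inter_insert_of_notMem, inter_singleton_of_mem,
      inter_singleton_of_notMem, hxy]

lemma ww_cross {r : ℕ} {a b : Fin r → V} (h : Function.Injective (Sum.elim a b)) (R : Finset V) :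
    ww a b R = if ∀ i, (R ∩ {a i, b i}).card = 1 then
      (-1 : ℝ) ^ (R ∩ Finset.image b Finset.univ).card else 0 := by
  obtain ⟨h1, h2, h3⟩ := inj_facts h
  split_ifs with hx
  · have e : R ∩ image b univ = (univ.filter (fun i => b i ∈ R)).image b := by
      ext x
      simp only [mem_inter, mem_image, mem_univ, true_and, mem_filter]
      constructor
      · rintro ⟨hR, i, rfl⟩; exact ⟨i, hR, rfl⟩
      · rintro ⟨i, hR, rfl⟩; exact ⟨hR, i, rfl⟩
    rw [e, card_image_of_injective _ h2, ← prod_const, prod_filter]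
    unfold ww
    refine prod_congr rfl fun i _ => ?_
    have := (inter_pair_card R _ _ (h3 i i)).1 (hx i)
    by_cases ha : a i ∈ R <;> by_cases hb : b i ∈ R <;> simp_all
  · push Not at hx
    obtain ⟨i, hi⟩ := hx
    unfold ww
    apply prod_eq_zero (mem_univ i)
    have := (inter_pair_card R _ _ (h3 i i)).not.1 hi
    by_cases ha : a i ∈ R <;> by_cases hb : b i ∈ R <;> simp_all

lemma ww_small {r : ℕ} {a b : Fin r → V} (h : Function.Injective (Sum.elim a b)) (k : ℕ)
    (T : Finset V) (hT : T.card < r) :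
    ∑ R ∈ powersetCard k (univ : Finset V), ww a b R * (if T ⊆ R then (1:ℝ) else 0) = 0 := by
  obtain ⟨h1, h2, h3⟩ := inj_facts h
  obtain ⟨i, hia, hib⟩ : ∃ i, a i ∉ T ∧ b i ∉ T := by
    by_contra hcon
    push Not at hcon
    have : (univ : Finset (Fin r)).card ≤ T.card := by
      apply card_le_card_of_injOn (fun i => if a i ∈ T then a i else b i)
      · intro i _
        simp only
        split_ifs with h'
        · exact h'
        · exact hcon i h'
      · intro i _ j _ hij
        simp only at hij
        split_ifs at hij
        · exact h1 hij
        · exact absurd hij (h3 _ _)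
        · exact absurd hij.symm (h3 _ _)
        · exact h2 hij
    simp at this
    omega
  set π : Equiv.Perm V := Equiv.swap (a i) (b i) with hπ
  have hmem : ∀ (R : Finset V) x, x ∈ R.map π.toEmbedding ↔ π x ∈ R := by
    intro R x
    rw [mem_map_equiv]
    simp [hπ]
  have hw : ∀ R, ww a b (R.map π.toEmbedding) = - ww a b R := by
    intro R
    unfold ww
    rw [← mul_prod_erase univ _ (mem_univ i), ← mul_prod_erase univ _ (mem_univ i), ← neg_mul]
    congr 1
    · simp only [hmem]
      simp [hπ]
    · refine prod_congr rfl fun j hj => ?_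
      have hj' : j ≠ i := ne_of_mem_erase hj
      simp only [hmem]
      rw [hπ, Equiv.swap_apply_of_ne_of_ne (h1.ne hj') (h3 _ _),
        Equiv.swap_apply_of_ne_of_ne (h3 _ _).symm (h2.ne hj')]
  have hs : ∀ R, T ⊆ R.map π.toEmbedding ↔ T ⊆ R := by
    intro R
    have hfix : ∀ x ∈ T, π x = x := by
      intro x hx
      rw [hπ, Equiv.swap_apply_of_ne_of_ne]
      · rintro rfl; exact hia hx
      · rintro rfl; exact hib hx
    constructor
    · intro h x hx
      have := (hmem R x).1 (h hx)
      rwa [hfix x hx] at this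
    · intro h x hx
      rw [hmem, hfix x hx]; exact h hx
  have hself : ∑ R ∈ powersetCard k (univ : Finset V), ww a b R * (if T ⊆ R then (1:ℝ) else 0)
      = ∑ R ∈ powersetCard k (univ : Finset V), -(ww a b R * (if T ⊆ R then (1:ℝ) else 0)) := by
    refine sum_nbij' (fun R => R.map π.toEmbedding) (fun R => R.map π.toEmbedding) ?_ ?_ ?_ ?_ ?_
    · intro R; simp
    · intro R; simp
    · intro R _
      ext x; simp only [hmem]; simp [hπ]
    · intro R _
      ext x; simp only [hmem]; simp [hπ]
    · intro R _
      simp only [hw, hs]; ring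
  rw [sum_neg_distrib] at hself
  linarith

lemma Harm.numer {c : Finset V → ℝ} (hc : Harm c) (k r : ℕ) (hrk : r ≤ k)
    (hn : 2 * k ≤ Fintype.card V) {a b : Fin r → V} (h : Function.Injective (Sum.elim a b)) :
    ∑ R ∈ powersetCard k (univ : Finset V), ww a b R * ∑ T ∈ R.powerset, c T
      = ((Fintype.card V - 2 * r).choose (k - r) : ℝ) * DD c a b := by
  have e1 : ∀ R ∈ powersetCard k (univ : Finset V), ww a b R * ∑ T ∈ R.powerset, c T
      = ∑ t ∈ range (k+1), ww a b R * ∑ T ∈ powersetCard t univ, (if T ⊆ R then c T else 0) := by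
    intro R hR
    simp only [mem_powersetCard, subset_univ, true_and] at hR
    rw [← mul_sum, Finset.sum_powerset, hR]
    congr 1
    refine sum_congr rfl fun t _ => ?_
    rw [← sum_filter]
    refine sum_congr ?_ fun _ _ => rfl
    ext T
    simp [mem_powersetCard]; tauto
  rw [sum_congr rfl e1, sum_comm, sum_eq_single r]
  · simp_rw [ww_expand, sum_mul]
    rw [sum_comm]
    unfold DD
    rw [mul_sum]
    refine sum_congr rfl fun I _ => ?_
    simp_rw [mul_assoc]
    rw [← mul_sum, hc.core k r r hrk hn hrk le_rfl _ (Xs_card h I), if_pos rfl]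
    ring
  · intro t ht htr
    have htk : t ≤ k := by simp at ht; omega
    rcases lt_or_gt_of_ne htr with hlt | hgt
    · simp_rw [mul_sum]
      rw [sum_comm]
      refine sum_eq_zero fun T hT => ?_
      simp only [mem_powersetCard, subset_univ, true_and] at hT
      have := ww_small h k T (by omega)
      calc _ = ∑ R ∈ powersetCard k (univ : Finset V),
            (ww a b R * (if T ⊆ R then (1:ℝ) else 0)) * c T := by
            refine sum_congr rfl fun R _ => ?_
            split_ifs <;> simp
        _ = 0 := by rw [← sum_mul, this, zero_mul]
    · simp_rw [ww_expand, sum_mul]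
      rw [sum_comm]
      refine sum_eq_zero fun I _ => ?_
      simp_rw [mul_assoc]
      rw [← mul_sum, hc.core k r t hrk hn htk hgt.le _ (Xs_card h I), if_neg htr, mul_zero]
  · intro hr
    simp at hr; omega

lemma denom (k r : ℕ) (hrk : r ≤ k) {a b : Fin r → V} (h : Function.Injective (Sum.elim a b)) :
    ((Finset.univ.powersetCard k).filter
      (fun R : Finset V => ∀ i, (R ∩ {a i, b i}).card = 1)).card
      = 2 ^ r * (Fintype.card V - 2 * r).choose (k - r) := by
  obtain ⟨h1, h2, h3⟩ := inj_facts h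
  rw [card_eq_sum_card_fiberwise (f := fun R => univ.filter (fun i => b i ∈ R))
    (t := (univ : Finset (Finset (Fin r)))) (by intro x _; simp)]
  rw [sum_congr rfl (g := fun _ => (Fintype.card V - 2 * r).choose (k - r))]
  · simp
  intro I _
  have hc1 := Xs_card h I
  have hc2 := Xs_card h Iᶜ
  have hd : Disjoint (Xs a b I) (Xs a b Iᶜ) := by
    rw [Finset.disjoint_left]
    intro x hx hx'
    simp only [Xs, mem_image, mem_univ, true_and, mem_compl] at hx hx'
    obtain ⟨i, rfl⟩ := hx
    obtain ⟨j, hj⟩ := hx'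
    by_cases hi : i ∈ I <;> by_cases hjI : j ∈ I <;> simp [hi, hjI] at hj
    · exact h3 _ _ hj
    · have := h2 hj; subst this; exact hjI hi
    · have := h1 hj; subst this; exact hi hjI
    · exact h3 _ _ hj.symm
  have := count2 k _ _ hd (by omega)
  rw [hc1, hc2, ← two_mul] at this
  rw [← this]
  congr 1
  ext R
  simp only [mem_filter, mem_powersetCard, subset_univ, true_and, and_assoc]
  refine and_congr_right fun _ => ?_
  rw [Xs_subset]
  have hdis : Disjoint R (Xs a b Iᶜ) ↔ (∀ i, i ∈ I → a i ∉ R) ∧ (∀ i, i ∉ I → b i ∉ R) := by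
    rw [← subset_compl_iff_disjoint_left, Xs_subset]
    simp
  rw [hdis]
  constructor
  · rintro ⟨hx, rfl⟩
    have hx' : ∀ i, ¬ (a i ∈ R ↔ b i ∈ R) := fun i => (inter_pair_card R _ _ (h3 i i)).1 (hx i)
    simp only [mem_filter, mem_univ, true_and]
    refine ⟨⟨fun i hi => ?_, fun i hi => hi⟩, fun i hi => ?_, fun i hi => hi⟩ <;>
    · have := hx' i; tauto
  · rintro ⟨⟨p1, p2⟩, p3, p4⟩
    refine ⟨fun i => (inter_pair_card R _ _ (h3 i i)).2 ?_, ?_⟩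
    · have := p1 i; have := p2 i; have := p3 i; have := p4 i; tauto
    · ext i
      have := p2 i; have := p4 i
      simp; tauto

end slice2

section slice3
variable {V : Type*} [Fintype V] [DecidableEq V]

lemma exists_perm (A T T' : Finset V) (hcard : T.card = T'.card) (hA : T ∩ A = T' ∩ A) :
    ∃ π : Equiv.Perm V, (∀ x ∈ A, π x = x) ∧ T.image π = T' := by
  classical
  have hc : (T \ A).card = (T' \ A).card := by
    have h1 := card_sdiff_add_card_inter T A
    have h2 := card_sdiff_add_card_inter T' A
    rw [hA] at h1
    omega
  let e := Finset.equivOfCardEq hc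
  let f : {x // x ∈ A ∪ T} → V := fun x =>
    if h : x.1 ∈ A then x.1 else
      (e ⟨x.1, by have := x.2; rw [mem_union] at this; rw [mem_sdiff]; tauto⟩ : V)
  have fA : ∀ x, ∀ h : x.1 ∈ A, f x = x.1 := fun x h => dif_pos h
  have fN : ∀ x, ∀ h : x.1 ∉ A, f x ∈ T' \ A := by
    intro x h
    simp only [f, dif_neg h]
    exact (e _).2
  have hf : Function.Injective f := by
    intro x y hxy
    by_cases hx : x.1 ∈ A <;> by_cases hy : y.1 ∈ A
    · rw [fA x hx, fA y hy] at hxy; exact Subtype.ext hxy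
    · exfalso
      have := fN y hy
      rw [← hxy, fA x hx, mem_sdiff] at this
      exact this.2 hx
    · exfalso
      have := fN x hx
      rw [hxy, fA y hy, mem_sdiff] at this
      exact this.2 hy
    · simp only [f, dif_neg hx, dif_neg hy] at hxy
      have := e.injective (Subtype.ext hxy)
      apply Subtype.ext
      simpa using this
  let E : {x // x ∈ A ∪ T} ≃ {x // x ∈ Set.range f} := Equiv.ofInjective f hf
  have hE : ∀ x (hx : x ∈ A ∪ T), E.extendSubtype x = f ⟨x, hx⟩ := by
    intro x hx
    rw [Equiv.extendSubtype_apply_of_mem E x hx]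
    rfl
  refine ⟨E.extendSubtype, ?_, ?_⟩
  · intro x hx
    rw [hE x (mem_union_left _ hx), fA _ hx]
  · apply eq_of_subset_of_card_le
    · rw [image_subset_iff]
      intro x hx
      rw [hE x (mem_union_right _ hx)]
      by_cases hxA : x ∈ A
      · rw [fA _ hxA]
        have : x ∈ T ∩ A := mem_inter.2 ⟨hx, hxA⟩
        rw [hA] at this
        exact (mem_inter.1 this).1
      · exact (mem_sdiff.1 (fN ⟨x, mem_union_right _ hx⟩ hxA)).1
    · rw [card_image_of_injective _ (Equiv.injective _), hcard]

lemma Xs_map {r : ℕ} (a b : Fin r → V) (I : Finset (Fin r)) (π : Equiv.Perm V) :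
    Xs (π ∘ a) (π ∘ b) I = (Xs a b I).image π := by
  unfold Xs
  rw [image_image]
  congr 1
  ext i
  simp only [Function.comp]
  split_ifs <;> rfl

lemma inj_map {r : ℕ} {a b : Fin r → V} (π : Equiv.Perm V)
    (h : Function.Injective (Sum.elim a b)) : Function.Injective (Sum.elim (π ∘ a) (π ∘ b)) := by
  rw [← Sum.comp_elim]
  exact π.injective.comp h

/-- constant fibre sums -/
lemma sum_const_fiber {ι : Type*} (s : Finset ι) (t : Finset (Finset V)) (g : ι → Finset V)
    (hg : ∀ i ∈ s, g i ∈ t)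
    (hK : ∀ T ∈ t, ∀ T' ∈ t, (s.filter (fun i => g i = T)).card ≤ (s.filter (fun i => g i = T')).card) :
    ∃ K : ℕ, ∀ h : Finset V → ℝ, ∑ i ∈ s, h (g i) = K * ∑ T ∈ t, h T := by
  rcases t.eq_empty_or_nonempty with rfl | ⟨T0, hT0⟩
  · refine ⟨0, fun h => ?_⟩
    rw [sum_eq_zero]
    · simp
    · intro i hi; simpa using hg i hi
  · refine ⟨(s.filter (fun i => g i = T0)).card, fun h => ?_⟩
    rw [← sum_fiberwise_of_maps_to hg, mul_sum]
    refine sum_congr rfl fun T hT => ?_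
    rw [le_antisymm (hK T0 hT0 T hT) (hK T hT T0 hT0), ← nsmul_eq_mul, ← sum_const]
    refine sum_congr rfl fun i hi => ?_
    rw [(mem_filter.1 hi).2]

lemma Harm.cross_nonneg {c : Finset V → ℝ} (hc : Harm c) {r : ℕ} (a : Fin r → V)
    (I : Finset (Fin r)) :
    0 ≤ ∑ b ∈ (univ : Finset (Fin r → V)).filter (fun b => Function.Injective (Sum.elim a b)),
      (-1 : ℝ) ^ I.card * c (Xs a b I) * c (univ.image a) := by
  by_cases ha : Function.Injective a
  swap
  · rw [filter_false_of_mem]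
    · simp
    · intro b _ h; exact ha (inj_facts h).1
  set A := univ.image a with hA
  set U := Iᶜ.image a with hU
  have hAc : A.card = r := by rw [hA, card_image_of_injective _ ha]; simp
  have hUA : U ⊆ A := image_subset_image (subset_univ _)
  obtain ⟨K, hK⟩ := sum_const_fiber
    ((univ : Finset (Fin r → V)).filter (fun b => Function.Injective (Sum.elim a b)))
    ((powersetCard A.card univ).filter (fun T => T ∩ A = U)) (fun b => Xs a b I) (by
      intro b hb
      simp only [mem_filter, mem_univ, true_and, mem_powersetCard, subset_univ] at hb ⊢
      refine ⟨by rw [Xs_card hb, hAc], ?_⟩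
      obtain ⟨h1, h2, h3⟩ := inj_facts hb
      ext x
      simp only [Xs, hA, hU, mem_inter, mem_image, mem_univ, true_and, mem_compl]
      constructor
      · rintro ⟨⟨i, rfl⟩, j, hj⟩
        by_cases hi : i ∈ I
        · rw [if_pos hi] at hj; exact absurd hj (h3 _ _)
        · exact ⟨i, hi, by rw [if_neg hi]⟩
      · rintro ⟨i, hi, rfl⟩
        exact ⟨⟨i, by rw [if_neg hi]⟩, i, rfl⟩) (by
      intro T hT T' hT'
      simp only [mem_filter, mem_powersetCard, subset_univ, true_and] at hT hT'
      obtain ⟨π, hπ1, hπ2⟩ := exists_perm A T T' (hT.1.trans hT'.1.symm) (hT.2.trans hT'.2.symm)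
      have hπa : π ∘ a = a := by
        ext i
        exact hπ1 _ (mem_image_of_mem _ (mem_univ _))
      apply card_le_card_of_injOn (fun b => π ∘ b)
      · intro b hb
        simp only [coe_filter, mem_filter, mem_univ, true_and, Set.mem_ofPred_eq] at hb ⊢
        have h1 := inj_map π hb.1
        have h2 := Xs_map a b I π
        rw [hπa] at h1 h2
        exact ⟨h1, by rw [h2, hb.2, hπ2]⟩
      · intro b _ b' _ h
        exact π.injective.comp_left h)
  rw [← sum_mul, ← mul_sum, hK, hc.F A U hUA]
  have hI : (A \ U).card = I.card := by
    rw [card_sdiff_of_subset hUA, hAc, hU, card_image_of_injective _ ha, card_compl,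
      Fintype.card_fin]
    have := card_le_univ I
    simp at this
    omega
  rw [hI]
  have : (-1 : ℝ) ^ I.card * (K * ((-1) ^ I.card * c A)) * c A
      = ((-1 : ℝ) ^ I.card) ^ 2 * K * (c A) ^ 2 := by ring
  rw [this]
  positivity

lemma Harm.third {c : Finset V → ℝ} (hc : Harm c) (r : ℕ) :
    ∑ p ∈ (univ : Finset ((Fin r → V) × (Fin r → V))).filter
        (fun p => Function.Injective (Sum.elim p.1 p.2)), (c (univ.image p.1)) ^ 2
    ≤ ∑ p ∈ (univ : Finset ((Fin r → V) × (Fin r → V))).filter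
        (fun p => Function.Injective (Sum.elim p.1 p.2)), (DD c p.1 p.2) ^ 2 := by
  set s := (univ : Finset ((Fin r → V) × (Fin r → V))).filter
        (fun p => Function.Injective (Sum.elim p.1 p.2)) with hs
  have h1 : ∑ p ∈ s, (c (univ.image p.1)) ^ 2 ≤ ∑ p ∈ s, DD c p.1 p.2 * c (univ.image p.1) := by
    unfold DD
    simp_rw [sum_mul]
    rw [sum_comm, ← add_sum_erase univ _ (mem_univ ∅)]
    have e0 : ∑ p ∈ s, (c (univ.image p.1)) ^ 2
        = ∑ p ∈ s, (-1:ℝ) ^ (∅ : Finset (Fin r)).card * c (Xs p.1 p.2 ∅) * c (univ.image p.1) := by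
      refine sum_congr rfl fun p _ => ?_
      simp [Xs, sq]
    rw [e0]
    apply le_add_of_nonneg_right
    apply sum_nonneg
    intro I _
    rw [hs, sum_filter, ← univ_product_univ, sum_product]
    apply sum_nonneg
    intro a _
    rw [← sum_filter]
    exact hc.cross_nonneg a I
  have h2 : 0 ≤ ∑ p ∈ s, (DD c p.1 p.2 - c (univ.image p.1)) ^ 2 :=
    sum_nonneg fun _ _ => sq_nonneg _
  have h3 : ∑ p ∈ s, (DD c p.1 p.2 - c (univ.image p.1)) ^ 2
      = ∑ p ∈ s, (DD c p.1 p.2) ^ 2 - 2 * ∑ p ∈ s, DD c p.1 p.2 * c (univ.image p.1)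
        + ∑ p ∈ s, (c (univ.image p.1)) ^ 2 := by
    rw [mul_sum, ← sum_sub_distrib, ← sum_add_distrib]
    exact sum_congr rfl fun _ _ => by ring
  linarith

lemma a_fiber (r : ℕ) : ∃ K : ℕ, ∀ h : Finset V → ℝ,
    ∑ p ∈ (univ : Finset ((Fin r → V) × (Fin r → V))).filter
        (fun p => Function.Injective (Sum.elim p.1 p.2)), h (univ.image p.1)
      = K * ∑ T ∈ powersetCard r univ, h T := by
  apply sum_const_fiber _ _ (fun p : (Fin r → V) × (Fin r → V) => univ.image p.1)
  · intro p hp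
    simp only [mem_filter, mem_univ, true_and, mem_powersetCard, subset_univ] at hp ⊢
    rw [card_image_of_injective _ (inj_facts hp).1]; simp
  · intro T hT T' hT'
    simp only [mem_powersetCard, subset_univ, true_and] at hT hT'
    obtain ⟨π, -, hπ⟩ := exists_perm ∅ T T' (hT.trans hT'.symm) (by simp)
    apply card_le_card_of_injOn (fun p => (π ∘ p.1, π ∘ p.2))
    · intro p hp
      simp only [coe_filter, mem_filter, mem_univ, true_and, Set.mem_ofPred_eq] at hp ⊢
      exact ⟨inj_map π hp.1, by rw [← image_image, hp.2, hπ]⟩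
    · intro b _ b' _ h
      simp only [Prod.mk.injEq] at h
      exact Prod.ext (π.injective.comp_left h.1) (π.injective.comp_left h.2)

/-- second moment of the homogeneous part -/
lemma Harm.second {c : Finset V → ℝ} (hc : Harm c) (k r : ℕ) (hrk : r ≤ k)
    (hn : 2 * k ≤ Fintype.card V) :
    ∑ R ∈ powersetCard k (univ : Finset V),
      (∑ T ∈ powersetCard r univ, (if T ⊆ R then c T else 0)) ^ 2
    = ((Fintype.card V - 2 * r).choose (k - r) : ℝ) * ∑ T ∈ powersetCard r univ, c T ^ 2 := by
  calc _ = ∑ R ∈ powersetCard k (univ : Finset V), ∑ A ∈ powersetCard r univ,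
        c A * ((if A ⊆ R then (1:ℝ) else 0) *
          ∑ T ∈ powersetCard r univ, (if T ⊆ R then c T else 0)) := by
        refine sum_congr rfl fun R _ => ?_
        rw [sq]
        conv_lhs => rw [sum_mul]
        refine sum_congr rfl fun A _ => ?_
        split_ifs <;> simp
    _ = _ := by
        rw [sum_comm, mul_sum]
        refine sum_congr rfl fun A hA => ?_
        simp only [mem_powersetCard, subset_univ, true_and] at hA
        rw [← mul_sum, hc.core k r r hrk hn hrk le_rfl A hA, if_pos rfl]
        ring

end slice3
section poly
open MvPolynomial
variable {n : ℕ}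

/-- exponent vector of a set -/
noncomputable def mI (T : Finset (Fin n)) : Fin n →₀ ℕ :=
  Finsupp.equivFunOnFinite.symm (fun i => if i ∈ T then 1 else 0)

lemma mI_apply (T : Finset (Fin n)) (i : Fin n) : mI T i = if i ∈ T then 1 else 0 := rfl

lemma mI_inj : Function.Injective (mI (n := n)) := by
  intro S T h
  ext i
  have := DFunLike.congr_fun h i
  rw [mI_apply, mI_apply] at this
  split_ifs at this <;> simp_all

lemma mI_degree (T : Finset (Fin n)) : (mI T).degree = T.card := by
  rw [Finsupp.degree_eq_sum]
  simp [mI_apply]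

lemma eval_ml (Q : MvPolynomial (Fin n) ℝ) (hml : ∀ m ∈ Q.support, ∀ i : Fin n, m i ≤ 1)
    (R : Finset (Fin n)) :
    eval (fun i => if i ∈ R then (1 : ℝ) else 0) Q = ∑ T ∈ R.powerset, coeff (mI T) Q := by
  rw [eval_eq']
  have hsub : Q.support ⊆ univ.image (mI (n := n)) := by
    intro m hm
    rw [mem_image]
    refine ⟨univ.filter (fun i => m i = 1), mem_univ _, ?_⟩
    ext i
    have := hml m hm i
    rw [mI_apply]
    simp only [mem_filter, mem_univ, true_and]
    split_ifs <;> omega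
  rw [sum_subset hsub (by intro m _ hm; rw [notMem_support_iff.1 hm, zero_mul]),
    sum_image (fun _ _ _ _ h => mI_inj h)]
  have : R.powerset = univ.filter (fun T => T ⊆ R) := by ext; simp
  rw [this, sum_filter]
  refine sum_congr rfl fun T _ => ?_
  have hp : ∏ i, (if i ∈ R then (1:ℝ) else 0) ^ (mI T i) = if T ⊆ R then 1 else 0 := by
    have : ∀ i ∈ (univ : Finset (Fin n)), (if i ∈ R then (1:ℝ) else 0) ^ (mI T i)
        = if (i ∈ T → i ∈ R) then 1 else 0 := by
      intro i _
      rw [mI_apply]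
      by_cases h1 : i ∈ T <;> by_cases h2 : i ∈ R <;> simp [h1, h2]
    rw [prod_congr rfl this, prod_boole]
    simp [subset_iff]
  rw [hp]
  split_ifs <;> simp

lemma harm_coeff (P : MvPolynomial (Fin n) ℝ) (hml : ∀ m ∈ P.support, ∀ i : Fin n, m i ≤ 1)
    (hharm : ∑ i : Fin n, pderiv i P = 0) : Harm (fun T => coeff (mI T) P) := by
  intro S
  have h := congrArg (coeff (mI S)) hharm
  rw [coeff_sum, coeff_zero] at h
  rw [← h, ← sum_subset (subset_univ Sᶜ)]
  · refine sum_congr rfl fun i hi => ?_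
    rw [mem_compl] at hi
    rw [coeff_pderiv]
    have : mI (insert i S) = mI S + Finsupp.single i 1 := by
      ext j
      simp only [Finsupp.add_apply, mI_apply, mem_insert, Finsupp.single_apply]
      by_cases hj : j = i
      · subst hj; simp [hi]
      · simp [hj, Ne.symm hj]
    simp only [this, mI_apply, if_neg hi]
    simp
  · intro i _ hi
    have hi' : i ∈ S := by simpa using hi
    rw [coeff_pderiv]
    have : coeff (mI S + Finsupp.single i 1) P = 0 := by
      by_contra hne
      have := hml _ (mem_support_iff.2 hne) i
      simp [mI_apply, hi'] at this
    rw [this, zero_mul]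

end poly

theorem stmt13 (n k r : ℕ) (hr : 1 ≤ r) (hrk : r ≤ k) (hn : 2 * k ≤ n)
    (P : MvPolynomial (Fin n) ℝ)
    (hml : ∀ m ∈ P.support, ∀ i : Fin n, m i ≤ 1)
    (hharm : ∑ i : Fin n, MvPolynomial.pderiv i P = 0) :
    (∑ S ∈ (Finset.univ : Finset (Fin n)).powersetCard k,
        (MvPolynomial.eval (fun i => if i ∈ S then (1 : ℝ) else 0)
          (MvPolynomial.homogeneousComponent r P)) ^ 2) /
      (((Finset.univ : Finset (Fin n)).powersetCard k).card : ℝ) ≤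
    4 ^ r * (k.choose r : ℝ) *
      (Wpow k r (fun S => MvPolynomial.eval
        (fun i => if i ∈ S then (1 : ℝ) else 0) P)) ^ 2 := by
  set c : Finset (Fin n) → ℝ := fun T => MvPolynomial.coeff (mI T) P with hcdef
  have hc : Harm c := harm_coeff P hml hharm
  have hn' : 2 * k ≤ Fintype.card (Fin n) := by simpa using hn
  set γ : ℝ := ((n - 2 * r).choose (k - r) : ℝ) with hγ
  have hγpos : 0 < γ := by
    rw [hγ]; exact_mod_cast Nat.choose_pos (by omega)
  set A2 : ℝ := ∑ T ∈ powersetCard r (univ : Finset (Fin n)), c T ^ 2 with hA2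
  have hA2nn : 0 ≤ A2 := sum_nonneg fun _ _ => sq_nonneg _
  -- left side
  have hL : ∑ S ∈ (Finset.univ : Finset (Fin n)).powersetCard k,
        (MvPolynomial.eval (fun i => if i ∈ S then (1 : ℝ) else 0)
          (MvPolynomial.homogeneousComponent r P)) ^ 2 = γ * A2 := by
    have := hc.second k r hrk hn'
    rw [Fintype.card_fin] at this
    rw [← this]
    refine sum_congr rfl fun S _ => ?_
    rw [eval_ml]
    · congr 1
      simp_rw [MvPolynomial.coeff_homogeneousComponent, mI_degree]
      rw [← sum_filter, ← sum_filter]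
      refine sum_congr ?_ fun _ _ => rfl
      ext T
      simp [mem_powersetCard]; tauto
    · intro m hm
      rw [MvPolynomial.mem_support_iff, MvPolynomial.coeff_homogeneousComponent] at hm
      apply hml
      rw [MvPolynomial.mem_support_iff]
      intro h0
      apply hm
      rw [h0, ite_self]
  -- the signed averages
  have hsa : ∀ p ∈ (Finset.univ : Finset ((Fin r → Fin n) × (Fin r → Fin n))).filter
        (fun p => Function.Injective (Sum.elim p.1 p.2)),
      (signedAvg k (fun S => MvPolynomial.eval
        (fun i => if i ∈ S then (1 : ℝ) else 0) P) p.1 p.2) ^ 2 = (DD c p.1 p.2) ^ 2 / 4 ^ r := by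
    intro p hp
    have hp' := (mem_filter.1 hp).2
    have h1 := hc.numer k r hrk hn' hp'
    have h2 := denom k r hrk hp'
    rw [Fintype.card_fin] at h1 h2
    unfold signedAvg
    rw [h2]
    have h3 : ∑ R ∈ (Finset.univ.powersetCard k).filter
        (fun R => ∀ i, (R ∩ {p.1 i, p.2 i}).card = 1),
        (-1 : ℝ) ^ (R ∩ Finset.image p.2 Finset.univ).card * MvPolynomial.eval
        (fun i => if i ∈ R then (1 : ℝ) else 0) P = γ * DD c p.1 p.2 := by
      rw [← h1, sum_filter]
      refine sum_congr rfl fun R _ => ?_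
      rw [ww_cross hp', eval_ml P hml]
      split_ifs <;> simp [hcdef]
    rw [h3]
    push_cast
    rw [← hγ, mul_comm γ, mul_div_mul_right _ _ hγpos.ne', div_pow, ← pow_mul, mul_comm r 2, pow_mul]
    norm_num
  obtain ⟨K, hK⟩ := a_fiber (V := Fin n) r
  set s := (Finset.univ : Finset ((Fin r → Fin n) × (Fin r → Fin n))).filter
        (fun p => Function.Injective (Sum.elim p.1 p.2)) with hs
  have hM : (s.card : ℝ) = K * (n.choose r : ℝ) := by
    have := hK (fun _ => 1)
    simpa using this
  have hMpos : (0:ℝ) < s.card := by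
    rw [Nat.cast_pos, card_pos]
    obtain ⟨e⟩ := Function.Embedding.nonempty_of_card_le (α := Fin r ⊕ Fin r) (β := Fin n)
      (by simp; omega)
    refine ⟨(e ∘ Sum.inl, e ∘ Sum.inr), ?_⟩
    rw [hs, mem_filter]
    refine ⟨mem_univ _, ?_⟩
    simp only [Sum.elim_comp_inl_inr]
    exact e.injective
  have hW : (Wpow k r (fun S => MvPolynomial.eval
        (fun i => if i ∈ S then (1 : ℝ) else 0) P)) ^ 2
      = (∑ p ∈ s, (DD c p.1 p.2) ^ 2) / 4 ^ r / s.card := by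
    unfold Wpow
    rw [Real.sq_sqrt (by positivity), ← hs, sum_congr rfl hsa, ← sum_div]
  have h3 := hc.third r
  rw [← hs, hK (fun T => c T ^ 2), ← hA2] at h3
  have hnr : (0:ℝ) < n.choose r := by exact_mod_cast Nat.choose_pos (by omega)
  have hnk : (0:ℝ) < n.choose k := by exact_mod_cast Nat.choose_pos (by omega)
  have hKpos : (0:ℝ) < K := by
    rw [hM] at hMpos
    exact pos_of_mul_pos_left hMpos hnr.le
  have hchoose : γ * n.choose r ≤ k.choose r * n.choose k := by
    have h1 : (n - 2 * r).choose (k - r) ≤ (n - r).choose (k - r) :=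
      Nat.choose_le_choose _ (by omega)
    have h2 := Nat.choose_mul (n := n) hrk
    have h3 : (n - 2 * r).choose (k - r) * n.choose r ≤ k.choose r * n.choose k := by
      rw [mul_comm (k.choose r), h2, mul_comm]
      exact Nat.mul_le_mul_left _ h1
    rw [hγ]
    exact_mod_cast h3
  rw [hL, hW, card_powersetCard, card_univ, Fintype.card_fin]
  calc γ * A2 / n.choose k ≤ k.choose r * (A2 / n.choose r) := by
        rw [div_le_iff₀ hnk, mul_div_assoc', div_mul_eq_mul_div, le_div_iff₀ hnr]
        nlinarith [mul_le_mul_of_nonneg_left hchoose hA2nn]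
    _ = k.choose r * (K * A2 / s.card) := by
        rw [hM, mul_div_mul_left _ _ hKpos.ne']
    _ ≤ k.choose r * ((∑ p ∈ s, (DD c p.1 p.2) ^ 2) / s.card) := by gcongr
    _ = _ := by field_simp
end
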